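/- For every vector ω₀ ∈ ℝ³ there exist a C^∞ function H : ℝ⁶ → ℝ with H(x,y) = ⟨ω₀, r(x,y)⟩ + O³(x,y) (i.e. H − ⟨ω₀, r⟩ vanishes at the origin together with its first and second total derivatives), a global flow Φ of X_H, and a sequence (a_n)_{n ∈ ℤ} of positive real numbers with a_n → 0 as n → −∞ and a_n → +∞ as n → +∞, such that: (i) each set {p : r₃(p) = a_n} (n ∈ ℤ) and each set {p : r_i(p) = 0} (i = 1,2,3) is invariant under Φ and on these sets one has r_j(Φ(t,p)) = r_j(p) for all j ≤ 3 and all t ∈ ℝ (so these manifolds are foliated by invariant tori); (ii) for every p with r_i(p) ≠ 0 for i = 1,2,3 and r₃(p) ∉ {a_n : n ∈ ℤ}, there is a sequence of times (t_j) such that either |Φ(t_j,p)| → ∞ or dist(Φ(t_j,p), ⋃_{i≤3}{r_i = 0} ∪ ⋃_{n∈ℤ}{r₃ = a_n}) → 0. -/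

import Mathlib

open Filter Topology Metric Set

noncomputable section

/-- Phase space `ℝ^d × ℝ^d`, a point is `p = (x, y)`. -/
abbrev Ph (d : ℕ) := (Fin d → ℝ) × (Fin d → ℝ)

/-- Action coordinates `r_j(p) = (x_j² + y_j²)/2`. -/
def actJ {d : ℕ} (j : Fin d) (p : Ph d) : ℝ := (p.1 j ^ 2 + p.2 j ^ 2) / 2

/-- The Hamiltonian vector field `X_H = (∂H/∂y, -∂H/∂x)`. -/
def hamVF {d : ℕ} (H : Ph d → ℝ) (p : Ph d) : Ph d :=
  (fun j => fderiv ℝ H p (0, Pi.single j 1),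
   fun j => - fderiv ℝ H p (Pi.single j 1, 0))

/-- `Φ` is a global flow of the Hamiltonian vector field `X_H`. -/
def IsGlobalFlow {d : ℕ} (H : Ph d → ℝ) (Φ : ℝ → Ph d → Ph d) : Prop :=
  (∀ p, Φ 0 p = p) ∧ (∀ s t p, Φ (s + t) p = Φ s (Φ t p)) ∧
  (∀ p t, HasDerivAt (fun τ => Φ τ p) (hamVF H (Φ t p)) t)

/-- `H(x,y) = ⟨ω, r(x,y)⟩ + O³(x,y)`: the difference `H - ⟨ω, r⟩` vanishes at the
origin together with its first and second total derivatives. -/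
def IsEllipticNF {d : ℕ} (ω : Fin d → ℝ) (H : Ph d → ℝ) : Prop :=
  ∀ k ≤ 2, iteratedFDeriv ℝ k (fun p => H p - ∑ j, ω j * actJ j p) 0 = 0

open scoped ContDiff

/-- The standard symplectic form on phase space. -/
def sympForm {d : ℕ} (u v : Ph d) : ℝ := ∑ j, (u.1 j * v.2 j - u.2 j * v.1 j)

section SympForm
variable {d : ℕ}

lemma sympForm_add_left (u u' v : Ph d) : sympForm (u + u') v = sympForm u v + sympForm u' v := by
  simp only [sympForm, ← Finset.sum_add_distrib]
  exact Finset.sum_congr rfl fun j _ => by simp; ring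

lemma sympForm_smul_left (c : ℝ) (u v : Ph d) : sympForm (c • u) v = c * sympForm u v := by
  simp only [sympForm, Finset.mul_sum]
  exact Finset.sum_congr rfl fun j _ => by simp; ring

lemma sympForm_swap (u v : Ph d) : sympForm u v = -sympForm v u := by
  simp only [sympForm, ← Finset.sum_neg_distrib]
  exact Finset.sum_congr rfl fun j _ => by ring

lemma sympForm_add_right (u v v' : Ph d) : sympForm u (v + v') = sympForm u v + sympForm u v' := by
  rw [sympForm_swap, sympForm_add_left, sympForm_swap v, sympForm_swap v']; ring

lemma sympForm_smul_right (c : ℝ) (u v : Ph d) : sympForm u (c • v) = c * sympForm u v := by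
  rw [sympForm_swap, sympForm_smul_left, sympForm_swap v]; ring

/-- The symplectic form with its first argument fixed, as a continuous linear functional of the
second, linearly in the first. -/
def sympFormCLM (d : ℕ) (v : Ph d) : Ph d →L[ℝ] ℝ :=
  LinearMap.toContinuousLinearMap
    { toFun := fun u => sympForm u v
      map_add' := fun u u' => sympForm_add_left u u' v
      map_smul' := fun c u => sympForm_smul_left c u v }

lemma ph_eq_sum (v : Ph d) : v = ∑ j, (v.1 j • ((Pi.single j 1, 0) : Ph d) +
    v.2 j • ((0, Pi.single j 1) : Ph d)) := by
  ext i <;> simp [Prod.fst_sum, Prod.snd_sum, Finset.sum_apply, Pi.single_apply]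

lemma sympForm_hamVF (H : Ph d → ℝ) (p v : Ph d) :
    sympForm (hamVF H p) v = fderiv ℝ H p v := by
  conv_rhs => rw [ph_eq_sum v]
  simp only [map_sum, map_add, map_smul, sympForm, hamVF, smul_eq_mul]
  exact Finset.sum_congr rfl fun j _ => by ring

lemma eq_of_sympForm_eq {u u' : Ph d} (h : ∀ v, sympForm u v = sympForm u' v) : u = u' := by
  ext i
  · simpa [sympForm, Pi.single_apply] using h (0, Pi.single i 1)
  · simpa [sympForm, Pi.single_apply] using h (Pi.single i 1, 0)

end SympForm

/-- A smooth symplectic diffeomorphism of phase space. -/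
structure IsSymplecto {d : ℕ} (e : Ph d ≃ Ph d) : Prop where
  contDiff : ContDiff ℝ ∞ e
  contDiff_symm : ContDiff ℝ ∞ e.symm
  symp : ∀ p u v, sympForm (fderiv ℝ e p u) (fderiv ℝ e p v) = sympForm u v

namespace IsSymplecto
variable {d : ℕ} {e e' : Ph d ≃ Ph d}

lemma refl : IsSymplecto (Equiv.refl (Ph d)) :=
  ⟨contDiff_id, contDiff_id, fun p u v => by
    rw [show ((Equiv.refl (Ph d) : Ph d ≃ Ph d) : Ph d → Ph d) = id from rfl]; simp⟩

lemma differentiable (he : IsSymplecto e) : Differentiable ℝ e :=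
  he.contDiff.differentiable (by simp)

lemma differentiable_symm (he : IsSymplecto e) : Differentiable ℝ e.symm :=
  he.contDiff_symm.differentiable (by simp)

lemma trans (he : IsSymplecto e) (he' : IsSymplecto e') : IsSymplecto (e.trans e') :=
  ⟨he'.contDiff.comp he.contDiff, he.contDiff_symm.comp he'.contDiff_symm, fun p u v => by
    rw [Equiv.coe_trans, fderiv_comp _ (he'.differentiable _) (he.differentiable _)]
    simp [he'.symp, he.symp]⟩

lemma fderiv_symm_comp (he : IsSymplecto e) (p u : Ph d) :
    fderiv ℝ e.symm (e p) (fderiv ℝ e p u) = u := by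
  have h := fderiv_comp p (he.differentiable_symm (e p)) (he.differentiable p)
  rw [show e.symm ∘ e = id from funext e.symm_apply_apply, fderiv_id] at h
  exact (congrArg (fun L : Ph d →L[ℝ] Ph d => L u) h).symm

lemma fderiv_comp_symm (he : IsSymplecto e) (p u : Ph d) :
    fderiv ℝ e p (fderiv ℝ e.symm (e p) u) = u := by
  have h := fderiv_comp (e p) (he.differentiable (e.symm (e p))) (he.differentiable_symm (e p))
  rw [show e ∘ e.symm = id from funext e.apply_symm_apply, fderiv_id, e.symm_apply_apply] at h
  exact (congrArg (fun L : Ph d →L[ℝ] Ph d => L u) h).symm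

lemma symm (he : IsSymplecto e) : IsSymplecto e.symm :=
  ⟨he.contDiff_symm, he.contDiff, fun p u v => by
    have := he.symp (e.symm p) (fderiv ℝ e.symm p u) (fderiv ℝ e.symm p v)
    have h := he.fderiv_comp_symm (e.symm p)
    rw [e.apply_symm_apply] at h
    rw [h, h] at this
    exact this.symm⟩

lemma pow_trans (he : IsSymplecto e) (n : ℕ) : IsSymplecto (e ^ n : Equiv.Perm (Ph d)) := by
  induction n with
  | zero => exact refl
  | succ n ih => rw [pow_succ]; exact he.trans ih

/-- Symplectic diffeomorphisms intertwine Hamiltonian vector fields. -/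
lemma fderiv_hamVF (he : IsSymplecto e) {h : Ph d → ℝ} (hh : Differentiable ℝ h) (p : Ph d) :
    fderiv ℝ e p (hamVF (h ∘ e) p) = hamVF h (e p) := by
  refine eq_of_sympForm_eq fun v => ?_
  have hv := he.fderiv_comp_symm p v
  rw [← hv, he.symp, sympForm_hamVF, sympForm_hamVF,
    fderiv_comp p (hh _) (he.differentiable p)]
  rfl

/-- Symplectic diffeomorphisms map integral curves to integral curves. -/
lemma hasDerivAt_symm_comp (he : IsSymplecto e) {h : Ph d → ℝ} (hh : Differentiable ℝ h)
    {γ : ℝ → Ph d} {t : ℝ} (hγ : HasDerivAt γ (hamVF h (γ t)) t) :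
    HasDerivAt (fun s => e.symm (γ s)) (hamVF (h ∘ e) (e.symm (γ t))) t := by
  have h1 := ((he.differentiable_symm (γ t)).hasFDerivAt).comp_hasDerivAt t hγ
  have h2 := he.fderiv_hamVF hh (e.symm (γ t))
  rw [e.apply_symm_apply] at h2
  have h3 := he.fderiv_symm_comp (e.symm (γ t)) (hamVF (h ∘ e) (e.symm (γ t)))
  rw [e.apply_symm_apply, h2] at h3
  rw [h3] at h1
  exact h1

end IsSymplecto

section Perturbation
variable {E : Type*} [NormedAddCommGroup E] [NormedSpace ℝ E]

/-- A perturbation of the identity by a `1/2`-Lipschitz map is a homeomorphism. -/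
lemma exists_homeomorph_add [CompleteSpace E] {X : E → E} (hX : LipschitzWith (1 / 2) X) :
    ∃ e : E ≃ₜ E, ∀ m, e m = m + X m := by
  have h : ApproximatesLinearOn (fun m => m + X m)
      ((ContinuousLinearEquiv.refl ℝ E : E ≃L[ℝ] E) : E →L[ℝ] E) univ (1 / 2) := by
    intro x _ y _
    have := hX.dist_le_mul x y
    rw [dist_eq_norm, dist_eq_norm] at this
    refine le_of_eq_of_le (congrArg norm ?_) this
    change x + X x - (y + X y) - (x - y) = X x - X y
    abel
  refine ⟨h.toHomeomorph _ ?_, fun m => rfl⟩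
  rcases subsingleton_or_nontrivial E with hE | hE
  · exact Or.inl hE
  · right
    have : ‖(((ContinuousLinearEquiv.refl ℝ E).symm : E ≃L[ℝ] E) : E →L[ℝ] E)‖₊ = 1 := by
      ext; exact ContinuousLinearMap.norm_id
    rw [this, inv_one]
    exact half_lt_self one_pos

lemma norm_fderiv_le_half {X : E → E} (hX : LipschitzWith (1 / 2) X) (m : E) :
    ‖fderiv ℝ X m‖ ≤ 1 / 2 := by
  simpa using norm_fderiv_le_of_lipschitz ℝ hX (x₀ := m)

/-- A perturbation of the identity by a smooth `1/2`-Lipschitz map is a diffeomorphism. -/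
lemma exists_homeomorph_add_contDiff [CompleteSpace E] {X : E → E} (hX : LipschitzWith (1 / 2) X)
    (hs : ContDiff ℝ ∞ X) :
    ∃ e : E ≃ₜ E, (∀ m, e m = m + X m) ∧ ContDiff ℝ ∞ e.symm := by
  obtain ⟨e, he⟩ := exists_homeomorph_add hX
  have hd : Differentiable ℝ X := hs.differentiable (by simp)
  have hlt : ∀ m, ‖-fderiv ℝ X m‖ < 1 := fun m => by
    rw [norm_neg]; linarith [norm_fderiv_le_half hX m]
  have hef : (e : E → E) = fun m => m + X m := funext he
  refine ⟨e, he, e.contDiff_symm (f₀' := fun m =>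
    ContinuousLinearEquiv.unitsEquiv ℝ E (Units.oneSub (-fderiv ℝ X m) (hlt m))) (fun a => ?_) ?_⟩
  · rw [hef]
    have : HasFDerivAt (fun m => m + X m) (ContinuousLinearMap.id ℝ E + fderiv ℝ X a) a :=
      (hasFDerivAt_id a).add (hd a).hasFDerivAt
    convert this using 1
    ext v
    simp
  · rw [hef]; exact contDiff_id.add hs

/-- `m ↦ m - X m` is onto an invariant complete subspace. -/
lemma exists_sub_eq_of_mem {X : E → E} (hX : LipschitzWith (1 / 2) X) {S : Submodule ℝ E}
    [CompleteSpace S] (hS : ∀ m ∈ S, X m ∈ S) {z : E} (hz : z ∈ S) : ∃ m ∈ S, m - X m = z := by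
  have h : LipschitzWith (1 / 2) fun m : S => (⟨-X m, S.neg_mem (hS m m.2)⟩ : S) :=
    LipschitzWith.of_dist_le_mul fun a b => by
      have := hX.dist_le_mul a b
      simpa [Subtype.dist_eq, dist_neg_neg] using this
  obtain ⟨e, he⟩ := exists_homeomorph_add h
  obtain ⟨m, hm⟩ := e.surjective ⟨z, hz⟩
  refine ⟨m, m.2, ?_⟩
  have := congrArg Subtype.val ((he m).symm.trans hm)
  simpa [sub_eq_add_neg] using this

end Perturbation

section Midpoint
variable {d : ℕ}

/-- The isomorphism sending the differential of `H` to the Hamiltonian vector field. -/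
def hamCLM (d : ℕ) : (Ph d →L[ℝ] ℝ) →L[ℝ] Ph d :=
  (ContinuousLinearMap.pi fun j => ContinuousLinearMap.apply ℝ ℝ ((0, Pi.single j 1) : Ph d)).prod
    (ContinuousLinearMap.pi fun j =>
      -ContinuousLinearMap.apply ℝ ℝ ((Pi.single j 1, 0) : Ph d))

lemma hamVF_eq (H : Ph d → ℝ) (p : Ph d) : hamVF H p = hamCLM d (fderiv ℝ H p) := by
  ext j <;> simp [hamVF, hamCLM]

lemma sympForm_hamCLM (L : Ph d →L[ℝ] ℝ) (v : Ph d) : sympForm (hamCLM d L) v = L v := by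
  conv_rhs => rw [ph_eq_sum v]
  simp only [map_sum, map_add, map_smul, sympForm, hamCLM, smul_eq_mul]
  exact Finset.sum_congr rfl fun j _ => by simp; ring

lemma hamVF_add {H K : Ph d → ℝ} {p : Ph d} (hH : DifferentiableAt ℝ H p)
    (hK : DifferentiableAt ℝ K p) :
    hamVF (fun q => H q + K q) p = hamVF H p + hamVF K p := by
  rw [hamVF_eq, hamVF_eq, hamVF_eq, fderiv_fun_add hH hK, map_add]

lemma hamVF_const_mul {H : Ph d → ℝ} {p : Ph d} (hH : DifferentiableAt ℝ H p) (c : ℝ) :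
    hamVF (fun q => c * H q) p = c • hamVF H p := by
  rw [hamVF_eq, hamVF_eq, fderiv_const_mul hH, map_smul]

lemma contDiff_hamVF {H : Ph d → ℝ} (hH : ContDiff ℝ ∞ H) : ContDiff ℝ ∞ (hamVF H) := by
  rw [show hamVF H = fun p => hamCLM d (fderiv ℝ H p) from funext (hamVF_eq H)]
  exact (hamCLM d).contDiff.comp (hH.fderiv_right (by simp))

/-- The implicit midpoint map of a Hamiltonian vector field is symplectic. -/
lemma exists_midpoint {F : Ph d → ℝ} (hF : ContDiff ℝ ∞ F)
    (hL : LipschitzWith (1 / 2) (hamVF F)) :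
    ∃ M : Ph d ≃ Ph d, IsSymplecto M ∧ ∀ m, M (m - hamVF F m) = m + hamVF F m := by
  have hX := contDiff_hamVF hF
  have hd : Differentiable ℝ (hamVF F) := hX.differentiable (by simp)
  have hL' : LipschitzWith (1 / 2) fun m => -hamVF F m := hL.neg
  obtain ⟨P, hP, hPs⟩ := exists_homeomorph_add_contDiff hL hX
  obtain ⟨N, hN, hNs⟩ := exists_homeomorph_add_contDiff hL' hX.neg
  have hPc : ContDiff ℝ ∞ P := by rw [show (P : Ph d → Ph d) = _ from funext hP]; fun_prop
  have hNc : ContDiff ℝ ∞ N := by rw [show (N : Ph d → Ph d) = _ from funext hN]; fun_prop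
  have hfP : ∀ m u, fderiv ℝ P m u = u + fderiv ℝ (hamVF F) m u := fun m u => by
    rw [show (P : Ph d → Ph d) = fun m => m + hamVF F m from funext hP,
      fderiv_fun_add differentiableAt_fun_id (hd m)]
    simp
  have hfN : ∀ m u, fderiv ℝ N m u = u - fderiv ℝ (hamVF F) m u := fun m u => by
    rw [show (N : Ph d → Ph d) = fun m => m + -hamVF F m from funext hN,
      fderiv_fun_add differentiableAt_fun_id (hd m).fun_neg, fderiv_fun_neg]
    simp [sub_eq_add_neg]
  have hsym : ∀ m u v, sympForm (fderiv ℝ (hamVF F) m u) v =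
      -sympForm u (fderiv ℝ (hamVF F) m v) := fun m u v => by
    have hd2 : DifferentiableAt ℝ (fderiv ℝ F) m :=
      (hF.fderiv_right (m := ∞) (by simp)).differentiable (by simp) m
    have key : ∀ u v, sympForm (fderiv ℝ (hamVF F) m u) v = fderiv ℝ (fderiv ℝ F) m u v := by
      intro u v
      rw [show hamVF F = fun p => hamCLM d (fderiv ℝ F p) from funext (hamVF_eq F)]
      have := ((hamCLM d).hasFDerivAt.comp m hd2.hasFDerivAt).fderiv
      rw [show (fun p => hamCLM d (fderiv ℝ F p)) = hamCLM d ∘ fderiv ℝ F from rfl, this]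
      exact sympForm_hamCLM _ _
    rw [sympForm_swap u, neg_neg, key, key]
    exact second_derivative_symmetric (f := F)
      (fun y => (hF.differentiable (by simp) y).hasFDerivAt)
      hd2.hasFDerivAt u v
  have hNP : ∀ m u v, sympForm (fderiv ℝ P m u) (fderiv ℝ P m v) =
      sympForm (fderiv ℝ N m u) (fderiv ℝ N m v) := fun m u v => by
    rw [hfP, hfP, hfN, hfN]
    simp only [sub_eq_add_neg, ← neg_one_smul ℝ (fderiv ℝ (hamVF F) m _), sympForm_add_left,
      sympForm_add_right, sympForm_smul_left, sympForm_smul_right, hsym]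
    ring
  refine ⟨N.toEquiv.symm.trans P.toEquiv, ⟨hPc.comp hNs, hNc.comp hPs, fun p u v => ?_⟩,
    fun m => ?_⟩
  · have hNd : DifferentiableAt ℝ N.symm p := hNs.differentiable (by simp) p
    have h1 : fderiv ℝ (N.toEquiv.symm.trans P.toEquiv : Ph d → Ph d) p =
        (fderiv ℝ P (N.symm p)).comp (fderiv ℝ N.symm p) :=
      fderiv_comp p (hPc.differentiable (by simp) _) hNd
    have h2 : (fderiv ℝ N (N.symm p)).comp (fderiv ℝ N.symm p) = ContinuousLinearMap.id ℝ _ := by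
      rw [← fderiv_comp p (hNc.differentiable (by simp) _) hNd,
        show N ∘ N.symm = id from funext N.apply_symm_apply, fderiv_id]
    have h3 : ∀ w, fderiv ℝ N (N.symm p) (fderiv ℝ N.symm p w) = w := fun w =>
      congrArg (fun L : Ph d →L[ℝ] Ph d => L w) h2
    rw [h1, ContinuousLinearMap.comp_apply, ContinuousLinearMap.comp_apply, hNP, h3, h3]
  · have : N m = m - hamVF F m := by rw [hN, sub_eq_add_neg]
    rw [← this]
    simp [hP]

end Midpoint

section Action
variable {d : ℕ}

/-- The vector of all actions. -/
def act (p : Ph d) : Fin d → ℝ := fun j => actJ j p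

lemma act_apply (p : Ph d) (j : Fin d) : act p j = (p.1 j ^ 2 + p.2 j ^ 2) / 2 := rfl

lemma act_nonneg (p : Ph d) (j : Fin d) : 0 ≤ act p j := by rw [act_apply]; positivity

@[fun_prop]
lemma contDiff_act {n : WithTop ℕ∞} : ContDiff ℝ n (act : Ph d → Fin d → ℝ) := by
  refine contDiff_pi.2 fun j => ?_
  simp only [act_apply]
  fun_prop

@[fun_prop]
lemma continuous_act : Continuous (act : Ph d → Fin d → ℝ) :=
  (contDiff_act (n := 0)).continuous

lemma isCompact_preimage_act {K : Set (Fin d → ℝ)} (hK : IsCompact K) :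
    IsCompact (act ⁻¹' K : Set (Ph d)) := by
  refine isCompact_of_isClosed_isBounded (hK.isClosed.preimage continuous_act) ?_
  obtain ⟨R, hR⟩ := hK.isBounded.exists_norm_le
  refine isBounded_iff_forall_norm_le.2 ⟨2 * R + 1, fun p hp => ?_⟩
  have h : ∀ j, p.1 j ^ 2 + p.2 j ^ 2 ≤ 2 * R := fun j => by
    have := (norm_le_pi_norm (act p) j).trans (hR _ hp)
    rw [Real.norm_eq_abs, abs_of_nonneg (act_nonneg p j), act_apply] at this
    linarith
  have hR0 : 0 ≤ R := (norm_nonneg _).trans (hR _ hp)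
  rw [Prod.norm_def, max_le_iff, pi_norm_le_iff_of_nonneg (by linarith),
    pi_norm_le_iff_of_nonneg (by linarith)]
  constructor <;> intro j <;> rw [Real.norm_eq_abs] <;> refine abs_le_of_sq_le_sq ?_ (by linarith)
  · nlinarith [h j, sq_nonneg (p.2 j)]
  · nlinarith [h j, sq_nonneg (p.1 j)]

lemma act_add_sub_act_sub (m v : Ph d) (j : Fin d) :
    act (m + v) j - act (m - v) j = 2 * (m.1 j * v.1 j + m.2 j * v.2 j) := by
  simp only [act_apply, Prod.fst_add, Prod.snd_add, Prod.fst_sub, Prod.snd_sub, Pi.add_apply,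
    Pi.sub_apply]
  ring

lemma norm_act_add_sub_le (m v : Ph d) :
    ‖act (m + v) - act m‖ ≤ 2 * ‖m‖ * ‖v‖ + ‖v‖ ^ 2 := by
  refine (pi_norm_le_iff_of_nonneg (by positivity)).2 fun j => ?_
  have h1 : |m.1 j| ≤ ‖m‖ := (norm_le_pi_norm m.1 j).trans (norm_fst_le m)
  have h2 : |m.2 j| ≤ ‖m‖ := (norm_le_pi_norm m.2 j).trans (norm_snd_le m)
  have h3 : |v.1 j| ≤ ‖v‖ := (norm_le_pi_norm v.1 j).trans (norm_fst_le v)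
  have h4 : |v.2 j| ≤ ‖v‖ := (norm_le_pi_norm v.2 j).trans (norm_snd_le v)
  have e : act (m + v) j - act m j =
      m.1 j * v.1 j + m.2 j * v.2 j + (v.1 j ^ 2 + v.2 j ^ 2) / 2 := by
    simp only [act_apply, Prod.fst_add, Prod.snd_add, Pi.add_apply]; ring
  rw [Pi.sub_apply, e, Real.norm_eq_abs]
  have h5 : |m.1 j * v.1 j| ≤ ‖m‖ * ‖v‖ := by rw [abs_mul]; gcongr
  have h6 : |m.2 j * v.2 j| ≤ ‖m‖ * ‖v‖ := by rw [abs_mul]; gcongr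
  have h7 : v.1 j ^ 2 ≤ ‖v‖ ^ 2 := sq_le_sq.2 (by rwa [abs_of_nonneg (norm_nonneg v)])
  have h8 : v.2 j ^ 2 ≤ ‖v‖ ^ 2 := sq_le_sq.2 (by rwa [abs_of_nonneg (norm_nonneg v)])
  rw [abs_le] at h5 h6 ⊢
  constructor <;> nlinarith [sq_nonneg (v.1 j), sq_nonneg (v.2 j)]

/-- The infinitesimal rotation `(-y_j, x_j)` in the `j`-th symplectic plane. -/
def rotDir (j : Fin d) (p : Ph d) : Ph d := (Pi.single j (-p.2 j), Pi.single j (p.1 j))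

/-- The radial vector `(x_j, y_j)` in the `j`-th symplectic plane. -/
def radDir (j : Fin d) (p : Ph d) : Ph d := (Pi.single j (p.1 j), Pi.single j (p.2 j))

lemma fderiv_rotDir (F : Ph d → ℝ) (p : Ph d) (j : Fin d) :
    fderiv ℝ F p (rotDir j p) = p.1 j * (hamVF F p).1 j + p.2 j * (hamVF F p).2 j := by
  have : rotDir j p = (-p.2 j) • ((Pi.single j 1, 0) : Ph d) +
      p.1 j • ((0, Pi.single j 1) : Ph d) := by
    ext i <;> by_cases h : i = j <;> simp [rotDir, h]
  rw [this, map_add, map_smul, map_smul]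
  simp [hamVF]; ring

lemma fderiv_radDir (F : Ph d → ℝ) (p : Ph d) (j : Fin d) :
    fderiv ℝ F p (radDir j p) = p.2 j * (hamVF F p).1 j - p.1 j * (hamVF F p).2 j := by
  have : radDir j p = p.1 j • ((Pi.single j 1, 0) : Ph d) +
      p.2 j • ((0, Pi.single j 1) : Ph d) := by
    ext i <;> simp [radDir, Pi.single_apply]
  rw [this, map_add, map_smul, map_smul]
  simp [hamVF]; ring

lemma hasLineDerivAt_act_rotDir (j : Fin d) (p : Ph d) :
    fderiv ℝ (act : Ph d → Fin d → ℝ) p (rotDir j p) = 0 := by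
  have hd : DifferentiableAt ℝ (act : Ph d → Fin d → ℝ) p :=
    (contDiff_act (n := 1)).differentiable (by simp) p
  rw [← hd.lineDeriv_eq_fderiv]
  refine HasDerivAt.deriv ?_
  have : (fun t : ℝ => act (p + t • rotDir j p)) =
      fun t => act p + t ^ 2 • Pi.single j (act p j) := by
    ext t i
    rcases eq_or_ne i j with rfl | h
    · simp [act_apply, rotDir]; ring
    · simp [act_apply, rotDir, h]
  rw [this]
  have h2 := (((hasDerivAt_pow 2 (0 : ℝ)).smul_const (Pi.single j (act p j))).const_add (act p))
  simpa using h2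

end Action

section Monomial
variable {d : ℕ}

/-- The complex coordinate `x_j + i y_j`. -/
def zc (j : Fin d) (p : Ph d) : ℂ := (p.1 j : ℂ) + (p.2 j : ℂ) * Complex.I

/-- `z ^ k` for `k ≥ 0` and `conj z ^ (-k)` for `k < 0`. -/
def wpow (k : ℤ) (z : ℂ) : ℂ :=
  if 0 ≤ k then z ^ k.natAbs else (starRingEnd ℂ z) ^ k.natAbs

/-- The resonant monomial `∏ z_j ^ (k_j)`. -/
def mono (k : Fin d → ℤ) (p : Ph d) : ℂ := ∏ j, wpow (k j) (zc j p)

lemma wpow_mul (k : ℤ) (z w : ℂ) : wpow k (z * w) = wpow k z * wpow k w := by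
  unfold wpow; split_ifs <;> simp [mul_pow]

@[simp] lemma wpow_one (k : ℤ) : wpow k 1 = 1 := by unfold wpow; split_ifs <;> simp

lemma wpow_ofReal (k : ℤ) (t : ℝ) : wpow k t = ((t ^ k.natAbs : ℝ) : ℂ) := by
  unfold wpow; split_ifs <;> simp

lemma wpow_ne_zero (k : ℤ) {z : ℂ} (hz : z ≠ 0) : wpow k z ≠ 0 := by
  unfold wpow; split_ifs <;> simp [hz]

lemma cast_natAbs_of_nonneg {k : ℤ} (h : 0 ≤ k) : ((k.natAbs : ℕ) : ℂ) = k := by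
  rw [← Int.cast_natCast, Int.natAbs_of_nonneg h]

lemma cast_natAbs_of_neg {k : ℤ} (h : ¬0 ≤ k) : ((k.natAbs : ℕ) : ℂ) = -k := by
  rw [← Int.cast_natCast, Int.ofNat_natAbs_of_nonpos (by omega), Int.cast_neg]

lemma wpow_exp (k : ℤ) (t : ℝ) :
    wpow k (Complex.exp (t * Complex.I)) = Complex.exp (k * t * Complex.I) := by
  unfold wpow
  split_ifs with h
  · rw [← Complex.exp_nat_mul]
    rw [cast_natAbs_of_nonneg h]; ring_nf
  · rw [← Complex.exp_conj, ← Complex.exp_nat_mul]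
    rw [cast_natAbs_of_neg h]; simp [Complex.conj_ofReal, mul_assoc]

lemma contDiff_zc (j : Fin d) : ContDiff ℝ ∞ (zc j : Ph d → ℂ) := by
  have h : ContDiff ℝ ∞ (fun x : ℝ => (x : ℂ)) := Complex.ofRealCLM.contDiff
  exact (h.comp (by fun_prop : ContDiff ℝ ∞ fun p : Ph d => p.1 j)).add
    ((h.comp (by fun_prop : ContDiff ℝ ∞ fun p : Ph d => p.2 j)).mul contDiff_const)

lemma contDiff_wpow (k : ℤ) : ContDiff ℝ ∞ (wpow k) := by
  by_cases h : 0 ≤ k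
  · rw [show wpow k = fun z => z ^ k.natAbs from funext fun z => by simp [wpow, h]]
    fun_prop
  · rw [show wpow k = fun z => (starRingEnd ℂ z) ^ k.natAbs from
      funext fun z => by simp [wpow, h]]
    exact (Complex.conjCLE.contDiff (n := ∞)).pow _

lemma contDiff_mono (k : Fin d → ℤ) : ContDiff ℝ ∞ (mono k) := by
  unfold mono
  exact contDiff_prod fun j _ => (contDiff_wpow (k j)).comp (contDiff_zc j)

lemma normSq_zc (j : Fin d) (p : Ph d) : Complex.normSq (zc j p) = 2 * act p j := by
  rw [zc, Complex.normSq_add_mul_I, act_apply]; ring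

lemma zc_ne_zero {j : Fin d} {p : Ph d} (h : 0 < act p j) : zc j p ≠ 0 := by
  rw [← Complex.normSq_pos, normSq_zc]; linarith

lemma mono_ne_zero (k : Fin d → ℤ) {p : Ph d} (h : ∀ j, 0 < act p j) : mono k p ≠ 0 :=
  Finset.prod_ne_zero_iff.2 fun j _ => wpow_ne_zero _ (zc_ne_zero (h j))

lemma mono_mul (k : Fin d → ℤ) {p q : Ph d} (c : Fin d → ℂ) (h : ∀ j, zc j q = zc j p * c j) :
    mono k q = mono k p * ∏ j, wpow (k j) (c j) := by
  rw [mono, mono, ← Finset.prod_mul_distrib]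
  exact Finset.prod_congr rfl fun j _ => by rw [h, wpow_mul]

lemma hasDerivAt_wpow_line (k : ℤ) (c : ℂ) :
    HasDerivAt (fun t : ℝ => wpow k (1 + t * c))
      (if 0 ≤ k then (k.natAbs : ℂ) * c else k.natAbs * starRingEnd ℂ c) 0 := by
  have key : ∀ (c : ℂ) (n : ℕ), HasDerivAt (fun t : ℝ => (1 + t * c) ^ n) (n * c) 0 := by
    intro c n
    have h1 : HasDerivAt (fun t : ℝ => 1 + (t : ℂ) * c) c 0 := by
      simpa using ((Complex.ofRealCLM.hasDerivAt (x := (0 : ℝ))).mul_const c).const_add 1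
    simpa using h1.fun_pow n
  unfold wpow
  split_ifs with h
  · exact key c _
  · have := key (starRingEnd ℂ c) k.natAbs
    simpa using this

lemma fderiv_mono_line (k : Fin d → ℤ) (p v : Ph d) (j : Fin d) (c : ℂ)
    (hv : ∀ t : ℝ, ∀ i, zc i (p + t • v) = zc i p * (1 + if i = j then t * c else 0)) :
    fderiv ℝ (mono k) p v =
      mono k p * if 0 ≤ k j then ((k j).natAbs : ℂ) * c else (k j).natAbs * starRingEnd ℂ c := by
  have hd : DifferentiableAt ℝ (mono k) p := (contDiff_mono k).differentiable (by simp) p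
  rw [← hd.lineDeriv_eq_fderiv]
  refine HasDerivAt.deriv ?_
  have : (fun t : ℝ => mono k (p + t • v)) = fun t : ℝ => mono k p * wpow (k j) (1 + t * c) := by
    ext t
    rw [mono_mul k _ (hv t), Finset.prod_eq_single j]
    · simp
    · intro i _ hi; simp [hi]
    · simp
  rw [this]
  exact (hasDerivAt_wpow_line (k j) c).const_mul _

lemma fderiv_mono_rotDir (k : Fin d → ℤ) (p : Ph d) (j : Fin d) :
    fderiv ℝ (mono k) p (rotDir j p) = mono k p * (k j * Complex.I) := by
  rw [fderiv_mono_line k p _ j Complex.I]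
  · congr 1
    split_ifs with h
    · rw [cast_natAbs_of_nonneg h]
    · rw [cast_natAbs_of_neg h]; simp
  · intro t i
    rcases eq_or_ne i j with rfl | h
    · simp only [zc, rotDir]
      apply Complex.ext <;> simp <;> ring
    · simp [zc, rotDir, h]

lemma fderiv_mono_radDir (k : Fin d → ℤ) (p : Ph d) (j : Fin d) :
    fderiv ℝ (mono k) p (radDir j p) = mono k p * ((k j).natAbs : ℝ) := by
  rw [fderiv_mono_line k p _ j 1]
  · rw [map_one, ite_self, mul_one, Complex.ofReal_natCast]
  · intro t i
    rcases eq_or_ne i j with rfl | h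
    · simp only [zc, radDir]
      apply Complex.ext <;> simp <;> ring
    · simp [zc, radDir, h]

end Monomial

section Push
variable {d : ℕ}

/-- A smooth plateau function between a compact set and an open neighbourhood. -/
lemma exists_plateau {C U : Set (Fin d → ℝ)} (hC : IsCompact C) (hU : IsOpen U) (hCU : C ⊆ U) :
    ∃ B : (Fin d → ℝ) → ℝ, ContDiff ℝ ∞ B ∧ (∀ r, 0 ≤ B r) ∧ IsCompact (tsupport B) ∧
      tsupport B ⊆ U ∧ ∃ η > 0, cthickening η C ⊆ B ⁻¹' {1} := by
  obtain ⟨δ, hδ, hδU⟩ := hC.exists_cthickening_subset_open hU hCU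
  have hdis : Disjoint (thickening δ C)ᶜ (cthickening (δ / 2) C) :=
    disjoint_compl_left_iff_subset.2 (cthickening_subset_thickening' hδ (by linarith) C)
  obtain ⟨f, hf0, hf1, hf⟩ := exists_contMDiffMap_zero_one_of_isClosed (n := (⊤ : ℕ∞))
    (modelWithCornersSelf ℝ (Fin d → ℝ)) isOpen_thickening.isClosed_compl isClosed_cthickening hdis
  have hs : tsupport f ⊆ cthickening δ C := by
    refine closure_minimal (fun x hx => ?_) isClosed_cthickening
    by_contra h
    exact hx (hf0 fun h' => h (thickening_subset_cthickening _ _ h'))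
  exact ⟨f, f.contMDiff.contDiff, fun r => (hf r).1,
    hC.cthickening.of_isClosed_subset (isClosed_tsupport _) hs, hs.trans hδU, δ / 2, by linarith,
    fun x hx => hf1 hx⟩

/-- The Hamiltonian of the pushing map. -/
def pushHam (B : (Fin d → ℝ) → ℝ) (k : Fin d → ℤ) (p : Ph d) : ℝ := B (act p) * (mono k p).im

variable {B : (Fin d → ℝ) → ℝ}

lemma contDiff_pushHam (hB : ContDiff ℝ ∞ B) (k : Fin d → ℤ) : ContDiff ℝ ∞ (pushHam B k) :=
  (hB.comp contDiff_act).mul (Complex.imCLM.contDiff.comp (contDiff_mono k))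

lemma fderiv_pushHam (hB : ContDiff ℝ ∞ B) (k : Fin d → ℤ) (p v : Ph d) :
    fderiv ℝ (pushHam B k) p v =
    B (act p) * (fderiv ℝ (mono k) p v).im +
      (mono k p).im * fderiv ℝ B (act p) (fderiv ℝ (act : Ph d → Fin d → ℝ) p v) := by
  have h1 : HasFDerivAt (fun p : Ph d => B (act p)) _ p :=
    (hB.differentiable (by simp) (act p)).hasFDerivAt.comp p
      ((contDiff_act (n := 1)).differentiable (by simp) p).hasFDerivAt
  have h2 : HasFDerivAt (fun p : Ph d => (mono k p).im) _ p :=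
    Complex.imCLM.hasFDerivAt.comp p ((contDiff_mono k).differentiable (by simp) p).hasFDerivAt
  rw [show pushHam B k = fun p => B (act p) * (mono k p).im from rfl, (h1.fun_mul h2).fderiv]
  simp

lemma rot_hamVF_pushHam (hB : ContDiff ℝ ∞ B) (k : Fin d → ℤ) (p : Ph d) (j : Fin d) :
    p.1 j * (hamVF (pushHam B k) p).1 j + p.2 j * (hamVF (pushHam B k) p).2 j =
      k j * (B (act p) * (mono k p).re) := by
  rw [← fderiv_rotDir, fderiv_pushHam hB, fderiv_mono_rotDir, hasLineDerivAt_act_rotDir, map_zero]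
  simp; ring

lemma rad_hamVF_pushHam (hB : ContDiff ℝ ∞ B) (k : Fin d → ℤ) (p : Ph d) (j : Fin d)
    (h : (mono k p).im = 0) :
    p.2 j * (hamVF (pushHam B k) p).1 j - p.1 j * (hamVF (pushHam B k) p).2 j = 0 := by
  rw [← fderiv_radDir, fderiv_pushHam hB, fderiv_mono_radDir, h, Complex.mul_im, h,
    Complex.ofReal_im]
  simp

lemma hamVF_pushHam_eq_zero (k : Fin d → ℤ) {p : Ph d} (h : act p ∉ tsupport B) :
    hamVF (pushHam B k) p = 0 := by
  have : p ∉ tsupport (pushHam B k) := fun hp => h <| by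
    have h1 : tsupport (pushHam B k) ⊆ act ⁻¹' tsupport B := by
      refine closure_minimal (fun x hx => ?_) ((isClosed_tsupport B).preimage continuous_act)
      exact subset_tsupport B fun h0 => hx (by simp [pushHam, h0])
    exact h1 hp
  rw [hamVF_eq, image_eq_zero_of_notMem_tsupport fun h' => this (tsupport_fderiv_subset ℝ h'),
    map_zero]

end Push

section Rays
variable {d : ℕ}

/-- The points obtained from `w` by rescaling every symplectic plane by a real factor. -/
def ray (w : Ph d) : (Fin d → ℝ) →ₗ[ℝ] Ph d where
  toFun τ := (fun j => τ j * w.1 j, fun j => τ j * w.2 j)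
  map_add' τ τ' := by ext j <;> simp [add_mul]
  map_smul' c τ := by ext j <;> simp [mul_assoc]

lemma ray_fst (w : Ph d) (τ : Fin d → ℝ) (j : Fin d) : (ray w τ).1 j = τ j * w.1 j := rfl
lemma ray_snd (w : Ph d) (τ : Fin d → ℝ) (j : Fin d) : (ray w τ).2 j = τ j * w.2 j := rfl

lemma ray_one (w : Ph d) : ray w (fun _ => 1) = w := by
  ext j <;> simp [ray]

lemma act_ray (w : Ph d) (τ : Fin d → ℝ) (j : Fin d) : act (ray w τ) j = τ j ^ 2 * act w j := by
  simp only [act_apply, ray_fst, ray_snd]; ring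

lemma mono_ray (k : Fin d → ℤ) (w : Ph d) (τ : Fin d → ℝ) :
    mono k (ray w τ) = ((∏ j, τ j ^ (k j).natAbs : ℝ) : ℂ) * mono k w := by
  rw [mono_mul k (p := w) (fun j => (τ j : ℂ)) fun j => by simp [zc, ray_fst, ray_snd]; ring,
    mul_comm, Complex.ofReal_prod]
  exact congrArg (· * _) (Finset.prod_congr rfl fun j _ => wpow_ofReal _ _)

/-- The pushing vector field preserves the rays through points with real monomial. -/
lemma hamVF_pushHam_mem_range_ray {B : (Fin d → ℝ) → ℝ} (hB : ContDiff ℝ ∞ B) (k : Fin d → ℤ)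
    (hpos : ∀ r ∈ tsupport B, ∀ j, 0 < r j) {w : Ph d} (hw : (mono k w).im = 0) :
    ∀ m ∈ LinearMap.range (ray w), hamVF (pushHam B k) m ∈ LinearMap.range (ray w) := by
  rintro _ ⟨τ, rfl⟩
  by_cases ht : act (ray w τ) ∈ tsupport B
  swap
  · rw [hamVF_pushHam_eq_zero k ht]; exact Submodule.zero_mem _
  set X := hamVF (pushHam B k) (ray w τ)
  have him : (mono k (ray w τ)).im = 0 := by
    rw [mono_ray, Complex.im_ofReal_mul, hw, mul_zero]
  have hrad := fun j => rad_hamVF_pushHam hB k (ray w τ) j him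
  have hne : ∀ j, (ray w τ).1 j ^ 2 + (ray w τ).2 j ^ 2 ≠ 0 := fun j => by
    have := hpos _ ht j
    rw [act_apply] at this
    exact ne_of_gt (by linarith)
  refine ⟨fun j => ((ray w τ).1 j * X.1 j + (ray w τ).2 j * X.2 j) /
    ((ray w τ).1 j ^ 2 + (ray w τ).2 j ^ 2) * τ j, ?_⟩
  ext j
  · rw [ray_fst, mul_assoc, ← ray_fst w, div_mul_eq_mul_div, div_eq_iff (hne j)]
    linear_combination -(ray w τ).2 j * hrad j
  · rw [ray_snd, mul_assoc, ← ray_snd w, div_mul_eq_mul_div, div_eq_iff (hne j)]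
    linear_combination (ray w τ).1 j * hrad j

end Rays

/-- Data for one pushing step: a small multiple `ε` of the pushing vector field, whose midpoint map
`M` moves actions by less than `η`. -/
structure PushData {d : ℕ} (k : Fin d → ℤ) (U C : Set (Fin d → ℝ)) where
  B : (Fin d → ℝ) → ℝ
  contDiff : ContDiff ℝ ∞ B
  nonneg : ∀ r, 0 ≤ B r
  pos : ∀ r ∈ U, ∀ j, 0 < r j
  tsupp : tsupport B ⊆ U
  ε : ℝ
  ε_pos : 0 < ε
  η : ℝ
  ball_sub : ∀ r ∈ tsupport B, ball r η ⊆ U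
  β : ℝ
  near : ∀ m : Ph d, act m ∈ cthickening η C → B (act m) = 1 ∧ β ≤ ‖mono k m‖
  lip : LipschitzWith (1 / 2) (ε • hamVF (pushHam B k))
  small : ∀ m : Ph d, act m ∈ tsupport B → ∀ s ∈ Icc (-1 : ℝ) 1,
    act (m + s • ε • hamVF (pushHam B k) m) ∈ ball (act m) η
  M : Ph d ≃ Ph d
  symp : IsSymplecto M
  M_sub : ∀ m, M (m - ε • hamVF (pushHam B k) m) = m + ε • hamVF (pushHam B k) m

namespace PushData
variable {d : ℕ} {k : Fin d → ℤ} {U C : Set (Fin d → ℝ)} (D : PushData k U C)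

lemma act_add (m : Ph d) :
    act (m + D.ε • hamVF (pushHam D.B k) m) = act (m - D.ε • hamVF (pushHam D.B k) m) +
      (2 * D.ε * (D.B (act m) * (mono k m).re)) • fun j => (k j : ℝ) := by
  ext j
  have h1 := act_add_sub_act_sub m (D.ε • hamVF (pushHam D.B k) m) j
  have h2 := rot_hamVF_pushHam D.contDiff k m j
  simp only [Prod.smul_fst, Prod.smul_snd, Pi.smul_apply, smul_eq_mul, Pi.add_apply] at h1 ⊢
  linear_combination h1 + 2 * D.ε * h2

lemma exists_act_eq (z : Ph d) : ∃ c : ℝ, act (D.M z) = act z + c • fun j => (k j : ℝ) := by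
  obtain ⟨m, -, rfl⟩ := exists_sub_eq_of_mem (S := ⊤) D.lip (fun _ _ => Submodule.mem_top)
    (Submodule.mem_top : z ∈ ⊤)
  exact ⟨_, (congrArg act (D.M_sub m)).trans (D.act_add m)⟩

lemma apply_eq_self {z : Ph d} (hz : act z ∉ tsupport D.B) : D.M z = z := by
  have := D.M_sub z
  rwa [hamVF_pushHam_eq_zero k hz, smul_zero, sub_zero, add_zero] at this

/-- One step of the pushing map along a ray with real monomial. -/
lemma ray_step {w : Ph d} (hwU : ∀ j, 0 < act w j) (hw : (mono k w).im = 0) {τ : Fin d → ℝ}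
    (hτ : ∀ j, 0 < τ j) (hU : act (ray w τ) ∈ U) :
    ∃ τ' : Fin d → ℝ, (∀ j, 0 < τ' j) ∧ D.M (ray w τ) = ray w τ' ∧
      ∃ c : ℝ, 0 ≤ c * (mono k w).re ∧ act (ray w τ') = act (ray w τ) + c • (fun j => (k j : ℝ)) ∧
        segment ℝ (act (ray w τ)) (act (ray w τ')) ⊆ U ∧
        (act (ray w τ) ∈ C → 2 * D.ε * D.β ≤ |c|) := by
  set Y := D.ε • hamVF (pushHam D.B k) with hY
  have hYS : ∀ m ∈ LinearMap.range (ray w), Y m ∈ LinearMap.range (ray w) := fun m hm =>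
    Submodule.smul_mem _ _ (hamVF_pushHam_mem_range_ray D.contDiff k
      (fun r hr => D.pos r (D.tsupp hr)) hw m hm)
  obtain ⟨_, ⟨μ, rfl⟩, hm⟩ := exists_sub_eq_of_mem D.lip hYS ⟨τ, rfl⟩
  obtain ⟨σ, hσ⟩ := hYS (ray w μ) ⟨μ, rfl⟩
  set m := ray w μ with hmdef
  have hinj : ∀ a b : Fin d → ℝ, ray w a = ray w b → a = b := fun a b hab => by
    ext j
    have h1 := congrArg (fun p : Ph d => p.1 j) hab
    have h2 := congrArg (fun p : Ph d => p.2 j) hab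
    simp only [ray_fst, ray_snd] at h1 h2
    have := hwU j
    rw [act_apply] at this
    have h3 : (a j - b j) * (w.1 j ^ 2 + w.2 j ^ 2) = 0 := by
      linear_combination w.1 j * h1 + w.2 j * h2
    rcases mul_eq_zero.1 h3 with h | h
    · linarith
    · linarith
  have hτμ : τ = μ - σ := hinj _ _ (by rw [map_sub, hσ]; exact hm.symm)
  have hMz : D.M (ray w τ) = ray w (μ + σ) := by
    rw [map_add, hσ, ← hm]; exact D.M_sub m
  have hact : act (ray w (μ + σ)) = act (ray w τ) +
      (2 * D.ε * (D.B (act m) * (mono k m).re)) • fun j => (k j : ℝ) := by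
    rw [map_add, hσ, ← hm]; exact D.act_add m
  have hball : act m ∈ tsupport D.B → ∀ s ∈ Icc (-1 : ℝ) 1,
      act (ray w (μ + s • σ)) ∈ ball (act m) D.η := fun ht s hs => by
    rw [map_add, map_smul, hσ]; exact D.small m ht s hs
  have hzero : act m ∉ tsupport D.B → σ = 0 := fun ht => by
    refine hinj _ _ ?_
    rw [hσ, map_zero, hY, Pi.smul_apply, hamVF_pushHam_eq_zero k ht, smul_zero]
  have hpos : ∀ s ∈ Icc (-1 : ℝ) 1, ∀ j, 0 < μ j + s * σ j := by
    intro s hs j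
    have h0 : 0 < μ j - σ j := by have := hτ j; rwa [hτμ] at this
    by_cases ht : act m ∈ tsupport D.B
    swap
    · have := congrFun (hzero ht) j
      simp only [Pi.zero_apply] at this
      rw [this] at h0 ⊢; linarith
    by_contra hneg
    push Not at hneg
    have hcont : ContinuousOn (fun s : ℝ => μ j + s * σ j) (Icc (-1) s) := by fun_prop
    obtain ⟨s', hs', h0'⟩ := intermediate_value_Icc' hs.1 hcont
      (show (0 : ℝ) ∈ _ from ⟨hneg, by linarith⟩)
    have h1 := D.pos _ (D.ball_sub _ ht (hball ht s' ⟨hs'.1, hs'.2.trans hs.2⟩)) j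
    rw [act_ray] at h1
    simp only [Pi.add_apply, Pi.smul_apply, smul_eq_mul] at h1 h0'
    rw [h0'] at h1
    simp at h1
  have hμ : ∀ j, 0 < μ j := fun j => by simpa using hpos 0 (by simp) j
  have hmono : mono k m = ((∏ j, μ j ^ (k j).natAbs : ℝ) : ℂ) * mono k w := mono_ray k w μ
  have hprod : 0 < ∏ j, μ j ^ (k j).natAbs := Finset.prod_pos fun j _ => pow_pos (hμ j) _
  have hre : (mono k m).re = (∏ j, μ j ^ (k j).natAbs) * (mono k w).re := by
    rw [hmono, Complex.re_ofReal_mul]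
  have him : (mono k m).im = 0 := by rw [hmono, Complex.im_ofReal_mul, hw, mul_zero]
  refine ⟨μ + σ, fun j => by simpa using hpos 1 (by simp) j, hMz, _, ?_, hact, ?_, ?_⟩
  · rw [hre]
    have : 0 ≤ 2 * D.ε * (D.B (act m) * ∏ j, μ j ^ (k j).natAbs) := by
      have := D.ε_pos; have := D.nonneg (act m); positivity
    nlinarith [mul_nonneg this (sq_nonneg (mono k w).re)]
  · by_cases ht : act m ∈ tsupport D.B
    · refine ((convex_ball (act m) D.η).segment_subset ?_ ?_).trans (D.ball_sub _ ht)
      · have := hball ht (-1) (by simp)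
        rwa [neg_one_smul, ← sub_eq_add_neg, ← hτμ] at this
      · simpa using hball ht 1 (by simp)
    · have h0 := hzero ht
      rw [h0, add_zero]
      rw [h0, sub_zero] at hτμ
      rw [← hτμ, segment_same]
      simpa using hU
  · intro hC
    have hnear : act m ∈ cthickening D.η C := by
      by_cases ht : act m ∈ tsupport D.B
      · refine thickening_subset_cthickening _ _ (mem_thickening_iff.2 ⟨_, hC, ?_⟩)
        have := hball ht (-1) (by simp)
        rwa [neg_one_smul, ← sub_eq_add_neg, ← hτμ, mem_ball, dist_comm] at this
      · rw [hzero ht, sub_zero] at hτμ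
        rw [hmdef, ← hτμ]
        exact self_subset_cthickening _ hC
    obtain ⟨hB1, hβ⟩ := D.near m hnear
    have hnorm : ‖mono k m‖ = |(mono k m).re| := by
      rw [← Complex.abs_re_eq_norm.2 him]
    rw [hB1, one_mul, abs_mul, ← hnorm, abs_of_pos (by linarith [D.ε_pos])]
    exact mul_le_mul_of_nonneg_left hβ (by linarith [D.ε_pos])

end PushData

section PushExists
variable {d : ℕ}

lemma exists_pos_le_norm_mono (k : Fin d → ℤ) {K : Set (Fin d → ℝ)} (hK : IsCompact K)
    (hpos : ∀ r ∈ K, ∀ j, 0 < r j) : ∃ β > 0, ∀ m : Ph d, act m ∈ K → β ≤ ‖mono k m‖ := by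
  rcases (act ⁻¹' K : Set (Ph d)).eq_empty_or_nonempty with he | hne
  · exact ⟨1, one_pos, fun m hm => (he.subset hm).elim⟩
  obtain ⟨m, hm, hmin⟩ := (isCompact_preimage_act hK).exists_isMinOn hne
    (contDiff_mono k).continuous.norm.continuousOn
  exact ⟨_, norm_pos_iff.2 (mono_ne_zero k (hpos _ hm)), fun m' hm' => hmin hm'⟩

lemma exists_pushData (k : Fin d → ℤ) {U C : Set (Fin d → ℝ)} (hU : IsOpen U)
    (hpos : ∀ r ∈ U, ∀ j, 0 < r j) (hC : IsCompact C) (hCU : C ⊆ U) :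
    ∃ D : PushData k U C, IsCompact (tsupport D.B) ∧ 0 < D.β := by
  obtain ⟨B, hB, hB0, hBc, hBU, η₁, hη₁, hB1⟩ := exists_plateau hC hU hCU
  obtain ⟨η₂, hη₂, hηU⟩ := hBc.exists_cthickening_subset_open hU hBU
  set η := min η₁ η₂ with hη
  have hη0 : 0 < η := lt_min hη₁ hη₂
  have hsub : cthickening η C ⊆ tsupport B := fun r hr => subset_tsupport _ (by
    have : B r = 1 := hB1 (cthickening_mono (min_le_left _ _) _ hr)
    simp [this])
  obtain ⟨β, hβ, hβm⟩ := exists_pos_le_norm_mono k hBc fun r hr => hpos r (hBU hr)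
  set X := hamVF (pushHam B k)
  have hsm := contDiff_pushHam hB k
  have hXs : ContDiff ℝ ∞ X := contDiff_hamVF hsm
  have hKc : IsCompact (act ⁻¹' tsupport B : Set (Ph d)) := isCompact_preimage_act hBc
  have hXc : HasCompactSupport X := HasCompactSupport.intro hKc fun p hp =>
    hamVF_pushHam_eq_zero k hp
  obtain ⟨L, hL⟩ := hXs.lipschitzWith_of_hasCompactSupport hXc (by simp)
  obtain ⟨A, hA⟩ := hXc.exists_bound_of_continuous hXs.continuous
  obtain ⟨R, hR⟩ := hKc.isBounded.exists_norm_le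
  have hA0 : 0 ≤ A := (norm_nonneg _).trans (hA 0)
  obtain ⟨ε, hε0, hε⟩ : ∃ ε > (0 : ℝ), ε * L ≤ 1 / 2 ∧ ε * A ≤ 1 ∧ (2 * |R| + 1) * (ε * A) < η := by
    have h : ∀ᶠ ε : ℝ in 𝓝[>] (0 : ℝ),
        ε * L ≤ 1 / 2 ∧ ε * A ≤ 1 ∧ (2 * |R| + 1) * (ε * A) < η := by
      refine (nhdsWithin_le_nhds ?_)
      refine Filter.Eventually.and ?_ (Filter.Eventually.and ?_ ?_)
      · exact (Continuous.tendsto' (by fun_prop) 0 0 (by simp)).eventually_le_const (by norm_num)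
      · exact (Continuous.tendsto' (by fun_prop) 0 0 (by simp)).eventually_le_const (by norm_num)
      · exact (Continuous.tendsto' (by fun_prop) 0 0 (by simp)).eventually_lt_const hη0
    obtain ⟨ε, h1, h2⟩ := (h.and self_mem_nhdsWithin).exists
    exact ⟨ε, h2, h1⟩
  have hlip : LipschitzWith (1 / 2) (ε • X) := LipschitzWith.of_dist_le_mul fun a b => by
    have h1 := hL.dist_le_mul a b
    rw [Pi.smul_apply, Pi.smul_apply, dist_smul₀, Real.norm_eq_abs, abs_of_pos hε0]
    calc ε * dist (X a) (X b) ≤ ε * (L * dist a b) := by gcongr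
      _ = (ε * L) * dist a b := by ring
      _ ≤ _ := by
        refine mul_le_mul_of_nonneg_right ?_ dist_nonneg
        simpa using hε.1
  have hham : hamVF (fun q => ε * pushHam B k q) = ε • X := by
    ext1 m
    exact hamVF_const_mul (hsm.differentiable (by simp) m) ε
  obtain ⟨M, hM, hMs⟩ := exists_midpoint (F := fun q => ε * pushHam B k q)
    (contDiff_const.mul hsm) (by rw [hham]; exact hlip)
  rw [hham] at hMs
  refine ⟨{ B := B, contDiff := hB, nonneg := hB0, pos := hpos, tsupp := hBU, ε := ε, ε_pos := hε0,
            η := η, ball_sub := fun r hr => ?_, β := β, near := fun m hm => ?_, lip := hlip,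
            small := fun m hm s hs => ?_, M := M, symp := hM, M_sub := hMs }, hBc, hβ⟩
  · refine (ball_subset_thickening hr η).trans ((thickening_subset_cthickening _ _).trans ?_)
    exact (cthickening_mono (min_le_right _ _) _).trans hηU
  · exact ⟨hB1 (cthickening_mono (min_le_left _ _) _ hm), hβm m (hsub hm)⟩
  · rw [mem_ball, dist_eq_norm]
    refine (norm_act_add_sub_le _ _).trans_lt ?_
    have h1 : ‖s • ε • X m‖ ≤ ε * A := by
      rw [norm_smul, norm_smul, Real.norm_eq_abs, Real.norm_eq_abs, abs_of_pos hε0]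
      calc |s| * (ε * ‖X m‖) ≤ 1 * (ε * A) := by
            gcongr
            · exact abs_le.2 hs
            · exact hA m
        _ = _ := one_mul _
    have h2 : ‖m‖ ≤ |R| := (hR m hm).trans (le_abs_self R)
    calc 2 * ‖m‖ * ‖s • ε • X m‖ + ‖s • ε • X m‖ ^ 2
        ≤ 2 * |R| * (ε * A) + (ε * A) ^ 2 := by gcongr
      _ ≤ (2 * |R| + 1) * (ε * A) := by nlinarith [mul_nonneg hε0.le hA0, hε.2.1]
      _ < η := hε.2.2

namespace PushData
variable {k : Fin d → ℤ} {U C : Set (Fin d → ℝ)} (D : PushData k U C)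

/-- The orbit of a point with real monomial under the pushing map. -/
lemma exists_chain {w : Ph d} (hwU : act w ∈ U) (hw : (mono k w).im = 0) :
    ∃ a : ℕ → ℝ, a 0 = 0 ∧ (∀ n, 0 ≤ (a (n + 1) - a n) * (mono k w).re) ∧
      (∀ n, act ((D.M ^ n : Equiv.Perm (Ph d)) w) = act w + a n • fun j => (k j : ℝ)) ∧
      (∀ n, segment ℝ (act w + a n • fun j => (k j : ℝ))
        (act w + a (n + 1) • fun j => (k j : ℝ)) ⊆ U) ∧
      ∀ n, act w + a n • (fun j => (k j : ℝ)) ∈ C → 2 * D.ε * D.β ≤ |a (n + 1) - a n| := by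
  have hray : ∀ n, ∃ τ : Fin d → ℝ, (∀ j, 0 < τ j) ∧
      (D.M ^ n : Equiv.Perm (Ph d)) w = ray w τ ∧ act (ray w τ) ∈ U := by
    intro n
    induction n with
    | zero => exact ⟨fun _ => 1, fun _ => one_pos, (ray_one w).symm, by rwa [ray_one]⟩
    | succ n ih =>
      obtain ⟨τ, hτ, hn, hU⟩ := ih
      obtain ⟨τ', hτ', hM, c, -, -, hseg, -⟩ := D.ray_step (D.pos _ hwU) hw hτ hU
      refine ⟨τ', hτ', ?_, hseg (right_mem_segment _ _ _)⟩
      rw [pow_succ', Equiv.Perm.mul_apply, hn, hM]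
  have hstep : ∀ n, ∃ c : ℝ, 0 ≤ c * (mono k w).re ∧
      act ((D.M ^ (n + 1) : Equiv.Perm (Ph d)) w) =
        act ((D.M ^ n : Equiv.Perm (Ph d)) w) + c • (fun j => (k j : ℝ)) ∧
      segment ℝ (act ((D.M ^ n : Equiv.Perm (Ph d)) w))
        (act ((D.M ^ (n + 1) : Equiv.Perm (Ph d)) w)) ⊆ U ∧
      (act ((D.M ^ n : Equiv.Perm (Ph d)) w) ∈ C → 2 * D.ε * D.β ≤ |c|) := by
    intro n
    obtain ⟨τ, hτ, hn, hU⟩ := hray n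
    obtain ⟨τ', hτ', hM, h⟩ := D.ray_step (D.pos _ hwU) hw hτ hU
    rw [pow_succ', Equiv.Perm.mul_apply, hn, hM]
    exact h
  choose c hc1 hc2 hc3 hc4 using hstep
  have ha : ∀ n, act ((D.M ^ n : Equiv.Perm (Ph d)) w) =
      act w + (∑ i ∈ Finset.range n, c i) • fun j => (k j : ℝ) := by
    intro n
    induction n with
    | zero => simp
    | succ n ih => rw [hc2, ih, Finset.sum_range_succ, add_smul, add_assoc]
  have hd : ∀ n, (∑ i ∈ Finset.range (n + 1), c i) - ∑ i ∈ Finset.range n, c i = c n := fun n => by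
    rw [Finset.sum_range_succ]; ring
  refine ⟨fun n => ∑ i ∈ Finset.range n, c i, by simp, fun n => ?_, ha, fun n => ?_, fun n h => ?_⟩
  · rw [hd]; exact hc1 n
  · rw [← ha, ← ha]; exact hc3 n
  · rw [hd]; exact hc4 n (by rwa [ha])

end PushData

/-- A monotone chain of segments inside a set covers the whole segment. -/
lemma chain_cover {U : Set (Fin d → ℝ)} {ρ κ : Fin d → ℝ} {a : ℕ → ℝ} (hmono : Monotone a)
    (h : ∀ n, segment ℝ (ρ + a n • κ) (ρ + a (n + 1) • κ) ⊆ U) (h0 : ρ + a 0 • κ ∈ U) (N : ℕ) :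
    ∀ s ∈ Icc (a 0) (a N), ρ + s • κ ∈ U := by
  induction N with
  | zero => intro s hs; rwa [le_antisymm hs.2 hs.1]
  | succ N ih =>
    intro s hs
    rcases le_total s (a N) with hsN | hsN
    · exact ih s ⟨hs.1, hsN⟩
    · refine h N ?_
      have : s ∈ segment ℝ (a N) (a (N + 1)) := by
        rw [segment_eq_Icc (hmono N.le_succ)]; exact ⟨hsN, hs.2⟩
      obtain ⟨x, y, hx, hy, hxy, rfl⟩ := this
      refine ⟨x, y, hx, hy, hxy, ?_⟩
      have : ρ = (x + y) • ρ := by rw [hxy, one_smul]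
      conv_rhs => rw [this]
      simp only [smul_add, add_smul, smul_smul, smul_eq_mul]
      abel

/-- The pushing lemma: a symplectic diffeomorphism supported over `U`, moving actions only along
`k`, such that of two points on the same torus with monomials of opposite real signs at least
one is sent outside `C` by its inverse. -/
lemma exists_push {k : Fin d → ℤ} (hk : k ≠ 0) {U C : Set (Fin d → ℝ)} (hU : IsOpen U)
    (hpos : ∀ r ∈ U, ∀ j, 0 < r j) (hC : IsCompact C) (hCU : C ⊆ U)
    (hseg : ∀ a ∈ C, ∀ b ∈ C, segment ℝ a b ⊆ U → segment ℝ a b ⊆ C) :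
    ∃ e : Ph d ≃ Ph d, IsSymplecto e ∧
      (∃ K : Set (Fin d → ℝ), IsCompact K ∧ K ⊆ U ∧ ∀ z, act z ∉ K → e z = z) ∧
      (∀ z, ∃ c : ℝ, act (e z) = act z + c • fun j => (k j : ℝ)) ∧
      ∀ w₁ w₂, act w₁ = act w₂ → act w₁ ∈ U → (mono k w₁).im = 0 → 0 < (mono k w₁).re →
        (mono k w₂).im = 0 → (mono k w₂).re < 0 →
        ¬(act (e.symm w₁) ∈ C ∧ act (e.symm w₂) ∈ C) := by
  obtain ⟨D, hDc, hβ⟩ := exists_pushData k hU hpos hC hCU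
  obtain ⟨R, hR⟩ := hC.isBounded.exists_norm_le
  have hε := D.ε_pos
  obtain ⟨N, hN⟩ := exists_nat_gt (2 * R / (2 * D.ε * D.β))
  rw [div_lt_iff₀ (by positivity)] at hN
  have hpow : ∀ n : ℕ, ∀ z, act z ∉ tsupport D.B → (D.M ^ n : Equiv.Perm (Ph d)) z = z := by
    intro n z hz
    induction n with
    | zero => rfl
    | succ n ih => rw [pow_succ, Equiv.Perm.mul_apply, D.apply_eq_self hz, ih]
  have hact : ∀ n : ℕ, ∀ z, ∃ c : ℝ,
      act ((D.M ^ n : Equiv.Perm (Ph d)) z) = act z + c • fun j => (k j : ℝ) := by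
    intro n z
    induction n with
    | zero => exact ⟨0, by simp⟩
    | succ n ih =>
      obtain ⟨c, hc⟩ := ih
      obtain ⟨c', hc'⟩ := D.exists_act_eq ((D.M ^ n : Equiv.Perm (Ph d)) z)
      exact ⟨c + c', by rw [pow_succ', Equiv.Perm.mul_apply, hc', hc, add_smul, add_assoc]⟩
  refine ⟨(D.M ^ N : Equiv.Perm (Ph d)).symm, (D.symp.pow_trans N).symm,
    ⟨_, hDc, D.tsupp, fun z hz => ?_⟩, fun z => ?_, ?_⟩
  · rw [Equiv.symm_apply_eq, hpow N z hz]
  · obtain ⟨c, hc⟩ := hact N ((D.M ^ N : Equiv.Perm (Ph d)).symm z)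
    rw [Equiv.apply_symm_apply] at hc
    exact ⟨-c, by rw [hc, neg_smul, add_neg_cancel_right]⟩
  rintro w₁ w₂ h12 hwU him₁ hre₁ him₂ hre₂ ⟨hC₁, hC₂⟩
  rw [Equiv.symm_symm] at hC₁ hC₂
  obtain ⟨a, ha0, hamono, haM, haseg, haC⟩ := D.exists_chain hwU him₁
  obtain ⟨b, hb0, hbmono, hbM, hbseg, -⟩ := D.exists_chain (h12 ▸ hwU) him₂
  set κ : Fin d → ℝ := fun j => (k j : ℝ) with hκ
  set ρ := act w₁ with hρ
  rw [← h12] at hbM hbseg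
  rw [haM] at hC₁
  rw [hbM] at hC₂
  have hainc : ∀ n, 0 ≤ a (n + 1) - a n := fun n => nonneg_of_mul_nonneg_left (hamono n) hre₁
  have ham : Monotone a := monotone_nat_of_le_succ fun n => by linarith [hainc n]
  have hbm : Monotone fun n => -b n := monotone_nat_of_le_succ fun n => by
    have : b (n + 1) - b n ≤ 0 := by
      by_contra h
      push Not at h
      nlinarith [hbmono n]
    linarith
  have hca := chain_cover ham haseg (by simpa [ha0] using hwU) N
  have hcb := chain_cover (a := fun n => -b n) (κ := -κ) (U := U) (ρ := ρ) hbm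
    (fun n => by simpa using hbseg n) (by simpa [hb0] using hwU) N
  rw [ha0] at hca
  simp only [hb0, neg_zero] at hcb
  have ha0N : 0 ≤ a N := by have := ham (Nat.zero_le N); rwa [ha0] at this
  have hb0N : b N ≤ 0 := by have := hbm (Nat.zero_le N); simp only [hb0] at this; linarith
  have key : ∀ s ∈ Icc (b N) (a N), ρ + s • κ ∈ segment ℝ (ρ + b N • κ) (ρ + a N • κ) := by
    intro s hs
    rw [← segment_eq_Icc (hb0N.trans ha0N)] at hs
    obtain ⟨x, y, hx, hy, hxy, rfl⟩ := hs
    refine ⟨x, y, hx, hy, hxy, ?_⟩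
    have : ρ = (x + y) • ρ := by rw [hxy, one_smul]
    conv_rhs => rw [this]
    simp only [smul_add, add_smul, smul_smul, smul_eq_mul]
    abel
  have hsub : segment ℝ (ρ + b N • κ) (ρ + a N • κ) ⊆ U := by
    rintro _ ⟨x, y, hx, hy, hxy, rfl⟩
    have e : x • (ρ + b N • κ) + y • (ρ + a N • κ) = ρ + (x * b N + y * a N) • κ := by
      have : ρ = (x + y) • ρ := by rw [hxy, one_smul]
      conv_rhs => rw [this]
      simp only [smul_add, add_smul, smul_smul]
      abel
    rw [e]
    rcases le_total 0 (x * b N + y * a N) with h | h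
    · exact hca _ ⟨h, by nlinarith⟩
    · have := hcb (-(x * b N + y * a N)) ⟨by linarith, by nlinarith⟩
      rwa [smul_neg, neg_smul, neg_neg] at this
  have hsC := hseg _ hC₂ _ hC₁ hsub
  have hrate : ∀ n ≤ N, n * (2 * D.ε * D.β) ≤ a n := by
    intro n hn
    induction n with
    | zero => simp [ha0]
    | succ n ih =>
      have h1 := ih (by omega)
      have h2 := haC n (hsC (key _ ⟨hb0N.trans (by rw [← ha0]; exact ham (Nat.zero_le n)),
        ham (by omega)⟩))
      rw [abs_of_nonneg (hainc n)] at h2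
      push_cast
      linarith
  have h3 := hrate N le_rfl
  have hρC : ρ ∈ C := by simpa using hsC (key 0 ⟨hb0N, ha0N⟩)
  have hκ1 : 1 ≤ ‖κ‖ := by
    obtain ⟨j, hj⟩ := Function.ne_iff.1 hk
    refine le_trans ?_ (norm_le_pi_norm κ j)
    rw [hκ, Real.norm_eq_abs, ← Int.cast_abs]
    exact_mod_cast Int.one_le_abs hj
  have h4 : a N ≤ 2 * R := by
    calc a N ≤ a N * ‖κ‖ := le_mul_of_one_le_right ha0N hκ1
      _ = ‖(ρ + a N • κ) - ρ‖ := by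
        rw [add_sub_cancel_left, norm_smul, Real.norm_eq_abs, abs_of_nonneg ha0N]
      _ ≤ ‖ρ + a N • κ‖ + ‖ρ‖ := norm_sub_le _ _
      _ ≤ 2 * R := by linarith [hR _ hC₁, hR _ hρC]
  linarith

end PushExists

section Rotation
variable {d : ℕ}

/-- Clockwise rotation by the angles `θ` in the symplectic planes. -/
def rot (θ : Fin d → ℝ) (p : Ph d) : Ph d :=
  (fun j => p.1 j * Real.cos (θ j) + p.2 j * Real.sin (θ j),
   fun j => -p.1 j * Real.sin (θ j) + p.2 j * Real.cos (θ j))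

@[simp] lemma rot_zero (p : Ph d) : rot 0 p = p := by
  ext j <;> simp [rot]

@[simp] lemma act_rot (θ : Fin d → ℝ) (p : Ph d) : act (rot θ p) = act p := by
  ext j
  simp only [act_apply, rot]
  linear_combination (p.1 j ^ 2 + p.2 j ^ 2) / 2 * Real.sin_sq_add_cos_sq (θ j)

lemma mono_rot (k : Fin d → ℤ) (θ : Fin d → ℝ) (p : Ph d) :
    mono k (rot θ p) = mono k p * Complex.exp (((-∑ j, k j * θ j : ℝ) : ℂ) * Complex.I) := by
  rw [mono_mul k (p := p) (fun j => Complex.exp (((-θ j : ℝ) : ℂ) * Complex.I))]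
  · rw [← Finset.sum_neg_distrib, Complex.ofReal_sum, Finset.sum_mul, Complex.exp_sum]
    refine congrArg _ (Finset.prod_congr rfl fun j _ => ?_)
    rw [wpow_exp]
    push_cast
    ring_nf
  · intro j
    rw [Complex.exp_mul_I, ← Complex.ofReal_cos, ← Complex.ofReal_sin, Real.cos_neg, Real.sin_neg]
    apply Complex.ext <;> simp [zc, rot]

/-- The frequency vector of an integrable Hamiltonian. -/
def freq (h : (Fin d → ℝ) → ℝ) (r : Fin d → ℝ) : Fin d → ℝ :=
  fun j => fderiv ℝ h r (Pi.single j 1)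

lemma sum_mul_freq (h : (Fin d → ℝ) → ℝ) (r v : Fin d → ℝ) :
    ∑ j, v j * freq h r j = fderiv ℝ h r v := by
  conv_rhs => rw [pi_eq_sum_univ' v]
  simp only [map_sum, map_smul, freq, smul_eq_mul]

lemma fderiv_act (q v : Ph d) :
    fderiv ℝ (act : Ph d → Fin d → ℝ) q v = fun j => q.1 j * v.1 j + q.2 j * v.2 j := by
  have hd : DifferentiableAt ℝ (act : Ph d → Fin d → ℝ) q :=
    (contDiff_act (n := 1)).differentiable (by simp) q
  rw [← hd.lineDeriv_eq_fderiv]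
  refine HasDerivAt.deriv (hasDerivAt_pi.2 fun j => ?_)
  have h1 : HasDerivAt (fun t : ℝ => q.1 j + t * v.1 j) (v.1 j) 0 := by
    simpa using ((hasDerivAt_id (0 : ℝ)).mul_const (v.1 j)).const_add (q.1 j)
  have h2 : HasDerivAt (fun t : ℝ => q.2 j + t * v.2 j) (v.2 j) 0 := by
    simpa using ((hasDerivAt_id (0 : ℝ)).mul_const (v.2 j)).const_add (q.2 j)
  have h3 := ((h1.fun_pow 2).add (h2.fun_pow 2)).div_const 2
  have h4 : HasDerivAt (fun t : ℝ => act (q + t • v) j) _ 0 := h3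
  refine h4.congr_deriv ?_
  norm_num
  ring

lemma hamVF_comp_act {h : (Fin d → ℝ) → ℝ} (hh : Differentiable ℝ h) (q : Ph d) :
    hamVF (fun p => h (act p)) q =
      (fun j => freq h (act q) j * q.2 j, fun j => -(freq h (act q) j * q.1 j)) := by
  have hc : ∀ v, fderiv ℝ (fun p : Ph d => h (act p)) q v =
      ∑ j, (q.1 j * v.1 j + q.2 j * v.2 j) * freq h (act q) j := fun v => by
    rw [sum_mul_freq, ← fderiv_act]
    exact congrArg (fun L : Ph d →L[ℝ] ℝ => L v) (fderiv_comp q (hh _)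
      ((contDiff_act (n := 1)).differentiable (by simp) q))
  ext j <;> simp [hamVF, hc, Pi.single_apply] <;> ring

/-- The orbits of an integrable Hamiltonian. -/
lemma hasDerivAt_rot {h : (Fin d → ℝ) → ℝ} (hh : Differentiable ℝ h) (p : Ph d) (t : ℝ) :
    HasDerivAt (fun t : ℝ => rot (t • freq h (act p)) p)
      (hamVF (fun p => h (act p)) (rot (t • freq h (act p)) p)) t := by
  rw [hamVF_comp_act hh, act_rot]
  set f := freq h (act p)
  have hl : ∀ j, HasDerivAt (fun t : ℝ => t * f j) (f j) t := fun j => by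
    simpa using (hasDerivAt_id t).mul_const (f j)
  refine HasDerivAt.prodMk (hasDerivAt_pi.2 fun j => ?_) (hasDerivAt_pi.2 fun j => ?_)
  · have h1 := ((hl j).cos.const_mul (p.1 j)).fun_add ((hl j).sin.const_mul (p.2 j))
    refine h1.congr_deriv ?_
    simp only [rot, Pi.smul_apply, smul_eq_mul]
    ring
  · have h1 := ((hl j).sin.const_mul (-p.1 j)).fun_add ((hl j).cos.const_mul (p.2 j))
    refine h1.congr_deriv ?_
    simp only [rot, Pi.smul_apply, smul_eq_mul]
    ring

/-- Along a rotation with non-vanishing resonant frequency, a nonzero monomial takes positive and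
negative real values. -/
lemma exists_mono_rot_real (k : Fin d → ℤ) {p : Ph d} (hp : mono k p ≠ 0) {f : Fin d → ℝ} {α : ℝ}
    (hα : α ≠ 0) (hf : ∑ j, k j * f j = α) :
    (∃ t ∈ Icc 0 (2 * Real.pi / |α|), (mono k (rot (t • f) p)).im = 0 ∧
      0 < (mono k (rot (t • f) p)).re) ∧
    ∃ t ∈ Icc 0 (2 * Real.pi / |α|), (mono k (rot (t • f) p)).im = 0 ∧
      (mono k (rot (t • f) p)).re < 0 := by
  have hα' : 0 < |α| := abs_pos.2 hα
  have key : ∀ θ : ℝ, ∃ t ∈ Icc 0 (2 * Real.pi / |α|), mono k (rot (t • f) p) =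
      ((‖mono k p‖ : ℝ) : ℂ) * Complex.exp (θ * Complex.I) := by
    intro θ
    obtain ⟨t, ht, n, hn⟩ : ∃ t ∈ Icc 0 (2 * Real.pi / |α|), ∃ n : ℤ,
        -(t * α) + (mono k p).arg = θ + n * (2 * Real.pi) := by
      have h2 : 0 < 2 * Real.pi / |α| := by positivity
      have h3 := toIcoMod_mem_Ico h2 0 (((mono k p).arg - θ) / α)
      rw [zero_add] at h3
      have h4 : toIcoMod h2 0 (((mono k p).arg - θ) / α) = ((mono k p).arg - θ) / α -
          toIcoDiv h2 0 (((mono k p).arg - θ) / α) * (2 * Real.pi / |α|) := by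
        rw [toIcoMod, zsmul_eq_mul]
      generalize toIcoDiv h2 0 (((mono k p).arg - θ) / α) = m at h4
      rw [h4] at h3
      refine ⟨_, ⟨h3.1, h3.2.le⟩, ?_⟩
      rcases abs_choice α with h | h <;> rw [h]
      · refine ⟨m, ?_⟩
        field_simp
        ring
      · refine ⟨-m, ?_⟩
        field_simp
        push_cast
        ring
    refine ⟨t, ht, ?_⟩
    have hsum : ∑ j, k j * (t • f) j = t * α := by
      rw [← hf, Finset.mul_sum]
      exact Finset.sum_congr rfl fun j _ => by rw [Pi.smul_apply, smul_eq_mul]; ring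
    conv_lhs => rw [mono_rot, hsum, ← Complex.norm_mul_exp_arg_mul_I (mono k p)]
    rw [mul_assoc, ← Complex.exp_add, ← add_mul, ← Complex.ofReal_add, add_comm, hn,
      Complex.exp_eq_exp_iff_exists_int.2 ⟨n, _⟩]
    push_cast
    ring
  have hn : 0 < ‖mono k p‖ := norm_pos_iff.2 hp
  obtain ⟨t, ht, h⟩ := key 0
  obtain ⟨t', ht', h'⟩ := key Real.pi
  refine ⟨⟨t, ht, ?_⟩, t', ht', ?_⟩
  · rw [h]; simpa using hp
  · rw [h', Complex.exp_pi_mul_I]; simpa using hp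

end Rotation

section Shells

lemma exists_profile : ∃ φ : ℝ → ℝ, ContDiff ℝ ∞ φ ∧ (∀ s, 2 ≤ s → s ≤ 64 ^ 3 → φ s = s) ∧
    ∀ s, s ≤ 1 ∨ 2 * 64 ^ 3 ≤ s → φ s = 0 := by
  obtain ⟨τ, h0, h1, -⟩ := exists_contMDiffMap_zero_one_of_isClosed (modelWithCornersSelf ℝ ℝ)
    (n := (⊤ : ℕ∞)) (s := Iic 1 ∪ Ici (2 * 64 ^ 3 : ℝ)) (t := Icc (2 : ℝ) (64 ^ 3))
    (isClosed_Iic.union isClosed_Ici) isClosed_Icc (by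
      refine Set.disjoint_left.2 fun x hx hx' => ?_
      rcases hx with hx | hx <;> simp only [mem_Iic, mem_Ici, mem_Icc] at hx hx' <;>
        norm_num at hx hx' <;> linarith)
  refine ⟨fun s => s * τ s, contDiff_id.mul τ.contMDiff.contDiff, fun s hs hs' => ?_,
    fun s hs => ?_⟩
  · simp [h1 ⟨hs, hs'⟩]
  · have : τ s = 0 := h0 hs
    simp [this]

/-- The cyclic index of the coordinate doubled in the `n`-th shell function. -/
def idx (n : ℤ) : Fin 3 := (n : ZMod 3)

/-- The `n`-th shell function `r₁ + r₂ + r₃ + r_{idx n}`. -/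
def shell (n : ℤ) (r : Fin 3 → ℝ) : ℝ := ∑ j, r j + r (idx n)

/-- The scale of the `n`-th shell. -/
def scale (n : ℤ) : ℝ := 64 ^ n

lemma scale_pos (n : ℤ) : 0 < scale n := by unfold scale; positivity

lemma scale_add_one (n : ℤ) : scale (n + 1) = 64 * scale n := by
  rw [scale, zpow_add_one₀ (by norm_num), mul_comm]; rfl

lemma scale_mono : Monotone scale := fun _ _ h => zpow_le_zpow_right₀ (by norm_num) h

lemma scale_add_three (n : ℤ) : scale (n + 3) = 64 ^ 3 * scale n := by
  rw [show n + 3 = n + 1 + 1 + 1 by ring]; simp only [scale_add_one]; ring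

lemma idx_sub_three (n : ℤ) : idx (n - 3) = idx n := by
  unfold idx
  rw [Int.cast_sub, show (((3 : ℤ) : ZMod 3)) = 0 from rfl, sub_zero]

lemma shell_sub_three (n : ℤ) : shell (n - 3) = shell n := by
  ext r; rw [shell, idx_sub_three]; rfl

lemma idx_distinct (n : ℤ) :
    idx (n - 1) ≠ idx n ∧ idx (n - 2) ≠ idx n ∧ idx (n - 1) ≠ idx (n - 2) := by
  have : ∀ a : ZMod 3, a - 1 ≠ a ∧ a - 2 ≠ a ∧ a - 1 ≠ a - 2 := by decide
  have := this n
  unfold idx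
  push_cast
  exact this

lemma sum_eq_idx (n : ℤ) (f : Fin 3 → ℝ) :
    ∑ j, f j = f (idx (n - 1)) + f (idx (n - 2)) + f (idx n) := by
  have : ∀ a : ZMod 3, ∑ j : ZMod 3, f j = f (a - 1 : ZMod 3) + f (a - 2 : ZMod 3) + f a := by
    intro a
    change ∑ j : Fin 3, f j = _
    rw [Fin.sum_univ_three]
    fin_cases a
    · change _ = f 2 + f 1 + f 0; ring
    · change _ = f 0 + f 2 + f 1; ring
    · change _ = f 1 + f 0 + f 2; ring
  have := this (n : ZMod 3)
  unfold idx
  push_cast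
  exact this

lemma shell_add_smul (n : ℤ) (r v : Fin 3 → ℝ) (t : ℝ) :
    shell n (r + t • v) = shell n r + t * shell n v := by
  simp only [shell, Pi.add_apply, Pi.smul_apply, smul_eq_mul, Finset.sum_add_distrib,
    ← Finset.mul_sum]
  ring

lemma le_shell (n : ℤ) {r : Fin 3 → ℝ} (hr : ∀ j, 0 ≤ r j) (j : Fin 3) : r j ≤ shell n r :=
  (Finset.single_le_sum (fun i _ => hr i) (Finset.mem_univ j)).trans
    (le_add_of_nonneg_right (hr _))

lemma shell_le (m n : ℤ) {r : Fin 3 → ℝ} (hr : ∀ j, 0 ≤ r j) : shell m r ≤ 2 * shell n r := by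
  have h1 := Finset.single_le_sum (fun i _ => hr i) (Finset.mem_univ (idx m))
  have h2 := hr (idx n)
  simp only [shell]
  linarith

@[fun_prop]
lemma contDiff_shell (n : ℤ) : ContDiff ℝ ∞ (shell n) := by unfold shell; fun_prop

/-- The `n`-th localised shell function. -/
def prof (n : ℤ) (s : ℝ) : ℝ := scale n * exists_profile.choose (s / scale n)

@[fun_prop]
lemma contDiff_prof (n : ℤ) : ContDiff ℝ ∞ (prof n) :=
  contDiff_const.mul (exists_profile.choose_spec.1.comp (contDiff_id.div_const _))

lemma prof_eq_self {n : ℤ} {s : ℝ} (h1 : 2 * scale n ≤ s) (h2 : s ≤ scale (n + 3)) :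
    prof n s = s := by
  have h := scale_pos n
  rw [prof, exists_profile.choose_spec.2.1, mul_div_cancel₀ _ h.ne']
  · rwa [le_div_iff₀ h]
  · rwa [div_le_iff₀ h, ← scale_add_three]

lemma prof_eq_zero {n : ℤ} {s : ℝ} (hs : s ≤ scale n ∨ 2 * scale (n + 3) ≤ s) : prof n s = 0 := by
  have h := scale_pos n
  rw [prof, exists_profile.choose_spec.2.2, mul_zero]
  rwa [div_le_one₀ h, le_div_iff₀ h, mul_assoc, ← scale_add_three]

/-- The family of integrable Hamiltonians, in action coordinates. -/
def intHam (w : Fin 3 → ℝ) (c : ℤ →₀ ℝ) (r : Fin 3 → ℝ) : ℝ :=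
  ∑ j, w j * r j + c.sum fun m a => a * prof m (shell m r)

@[fun_prop]
lemma contDiff_intHam (w : Fin 3 → ℝ) (c : ℤ →₀ ℝ) : ContDiff ℝ ∞ (intHam w c) := by
  unfold intHam Finsupp.sum
  fun_prop

lemma intHam_add_single (w : Fin 3 → ℝ) (c : ℤ →₀ ℝ) (m : ℤ) (a : ℝ) (r : Fin 3 → ℝ) :
    intHam w (c + Finsupp.single m a) r = intHam w c r + a * prof m (shell m r) := by
  unfold intHam
  rw [Finsupp.sum_add_index' (by simp) (by intros; ring), Finsupp.sum_single_index (by simp)]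
  ring

/-- The part of action space near the `n`-th shell. -/
def annulus (n : ℤ) : Set (Fin 3 → ℝ) :=
  {r | scale n / 16 < shell n r ∧ shell n r < 32 * scale n}

lemma isOpen_annulus (n : ℤ) : IsOpen (annulus n) :=
  (isOpen_lt continuous_const (contDiff_shell n).continuous).inter
    (isOpen_lt (contDiff_shell n).continuous continuous_const)

lemma intHam_eq (w : Fin 3 → ℝ) (c : ℤ →₀ ℝ) {n : ℤ} {r : Fin 3 → ℝ} (hr : ∀ j, 0 ≤ r j)
    (hn : r ∈ annulus n) :
    intHam w c r = ∑ j, w j * r j + c (n - 1) * shell (n - 1) r + c (n - 2) * shell (n - 2) r +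
      c n * prof n (shell n r) + c (n - 3) * prof (n - 3) (shell n r) := by
  have e1 : scale n = 64 * scale (n - 1) := by rw [← scale_add_one]; ring_nf
  have e2 : scale (n - 1) = 64 * scale (n - 2) := by rw [← scale_add_one]; ring_nf
  have e3 := scale_add_three (n - 1)
  have e4 := scale_add_three (n - 2)
  have p1 := scale_pos (n - 2)
  have hlo : ∀ m, scale n / 32 < shell m r := fun m => by linarith [shell_le n m hr, hn.1]
  have hhi : ∀ m, shell m r < 64 * scale n := fun m => by linarith [shell_le m n hr, hn.2]
  have h0 : ∀ m, m ∉ ({n - 1, n - 2, n, n - 3} : Finset ℤ) → prof m (shell m r) = 0 := by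
    intro m hm
    simp only [Finset.mem_insert, Finset.mem_singleton, not_or] at hm
    refine prof_eq_zero ?_
    rcases lt_or_ge n m with h | h
    · left
      have := scale_mono (show n + 1 ≤ m by lia)
      rw [scale_add_one] at this
      exact (hhi m).le.trans this
    · right
      have := scale_mono (show m + 3 ≤ n - 1 by lia)
      linarith [hlo m]
  rw [intHam, Finsupp.sum, Finset.sum_subset Finset.subset_union_left
    (s₂ := c.support ∪ {n - 1, n - 2, n, n - 3})
    (fun m _ hm => by rw [Finsupp.notMem_support_iff.1 hm, zero_mul]),
    ← Finset.sum_subset Finset.subset_union_right (fun m _ hm => by rw [h0 m hm, mul_zero])]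
  rw [Finset.sum_insert (by simp), Finset.sum_insert (by simp), Finset.sum_insert (by simp; lia),
    Finset.sum_singleton, prof_eq_self (n := n - 1), prof_eq_self (n := n - 2), shell_sub_three]
  · ring
  · linarith [hlo (n - 2)]
  · linarith [hhi (n - 2)]
  · linarith [hlo (n - 1)]
  · linarith [hhi (n - 1)]

/-- The rate of change of the integrable Hamiltonian along directions tangent to the shell. -/
def rate (w : Fin 3 → ℝ) (c : ℤ →₀ ℝ) (n : ℤ) (v : Fin 3 → ℝ) : ℝ :=
  ∑ j, w j * v j + c (n - 1) * shell (n - 1) v + c (n - 2) * shell (n - 2) v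

lemma intHam_add_smul (w : Fin 3 → ℝ) (c : ℤ →₀ ℝ) {n : ℤ} {r v : Fin 3 → ℝ} {t : ℝ}
    (hr : ∀ j, 0 ≤ r j) (hn : r ∈ annulus n) (hv : shell n v = 0)
    (hr' : ∀ j, 0 ≤ (r + t • v) j) :
    intHam w c (r + t • v) = intHam w c r + t * rate w c n v := by
  have hs : shell n (r + t • v) = shell n r := by rw [shell_add_smul, hv]; ring
  rw [intHam_eq w c hr hn, intHam_eq w c hr' (by rwa [annulus, mem_ofPred_eq, hs]), hs,
    shell_add_smul, shell_add_smul, rate]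
  simp only [Pi.add_apply, Pi.smul_apply, smul_eq_mul, mul_add, Finset.sum_add_distrib,
    Finset.mul_sum]
  have : ∑ j, w j * (t * v j) = ∑ j, t * (w j * v j) :=
    Finset.sum_congr rfl fun j _ => by ring
  rw [this]
  ring

lemma fderiv_intHam (w : Fin 3 → ℝ) (c : ℤ →₀ ℝ) {n : ℤ} {r v : Fin 3 → ℝ}
    (hr : ∀ j, 0 < r j) (hn : r ∈ annulus n) (hv : shell n v = 0) :
    fderiv ℝ (intHam w c) r v = rate w c n v := by
  rw [← ((contDiff_intHam w c).differentiable (by simp) r).lineDeriv_eq_fderiv]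
  have hev : ∀ᶠ t : ℝ in 𝓝 0, ∀ j, 0 < (r + t • v) j := by
    refine eventually_all.2 fun j => ?_
    have : ContinuousAt (fun t : ℝ => (r + t • v) j) 0 := by
      simp only [Pi.add_apply, Pi.smul_apply, smul_eq_mul]; fun_prop
    exact this.eventually (lt_mem_nhds (by simpa using hr j))
  have h1 : (fun t : ℝ => intHam w c (r + t • v)) =ᶠ[𝓝 0]
      fun t => intHam w c r + t * rate w c n v :=
    hev.mono fun t ht => intHam_add_smul w c (fun j => (hr j).le) hn hv fun j => (ht j).le
  rw [lineDeriv, h1.deriv_eq]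
  simp

/-- Resonant directions tangent to a shell exist after an arbitrarily small perturbation. -/
lemma exists_resonance (w : Fin 3 → ℝ) (c : ℤ →₀ ℝ) (n : ℤ) {ε : ℝ} (hε : 0 < ε) :
    ∃ δ₁ δ₂ : ℝ, |δ₁| ≤ ε ∧ |δ₂| ≤ ε ∧ ∃ k : Fin 3 → ℤ,
      shell n (fun j => (k j : ℝ)) = 0 ∧ shell (n - 1) (fun j => (k j : ℝ)) ≠ 0 ∧
      rate w (c + Finsupp.single (n - 1) δ₁ + Finsupp.single (n - 2) δ₂) n
        (fun j => (k j : ℝ)) = 0 := by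
  obtain ⟨h1, h2, h3⟩ := idx_distinct n
  set y₁ := w (idx (n - 1)) - (∑ j, w j) / 4 + c (n - 1)
  set y₂ := w (idx (n - 2)) - (∑ j, w j) / 4 + c (n - 2)
  obtain ⟨q₁, hq₁, hq₁'⟩ := exists_rat_btwn (show y₁ < y₁ + ε by linarith)
  obtain ⟨q₂, hq₂, hq₂', hq₂0⟩ : ∃ q : ℚ, y₂ - ε < q ∧ (q : ℝ) < y₂ + ε ∧ q ≠ 0 := by
    rcases le_or_gt 0 y₂ with h | h
    · obtain ⟨q, hq, hq'⟩ := exists_rat_btwn (show y₂ < y₂ + ε by linarith)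
      refine ⟨q, by linarith, hq', fun h0 => ?_⟩
      rw [h0, Rat.cast_zero] at hq
      linarith
    · obtain ⟨q, hq, hq'⟩ := exists_rat_btwn (show y₂ - ε < y₂ by linarith)
      refine ⟨q, hq, by linarith, fun h0 => ?_⟩
      rw [h0, Rat.cast_zero] at hq'
      linarith
  refine ⟨q₁ - y₁, q₂ - y₂, abs_le.2 ⟨by linarith, by linarith⟩,
    abs_le.2 ⟨by linarith, by linarith⟩, ?_⟩
  set A : ℤ := q₂.num * q₁.den
  set B : ℤ := -(q₁.num * q₂.den)
  set κ : Fin 3 → ℤ := fun i => if i = idx (n - 1) then A else if i = idx (n - 2) then B else 0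
  set k : Fin 3 → ℤ := fun i => 4 * κ i - (A + B)
  have κ1 : κ (idx (n - 1)) = A := by simp [κ]
  have κ2 : κ (idx (n - 2)) = B := by simp [κ, h3.symm]
  have κ0 : κ (idx n) = 0 := by simp [κ, h1.symm, h2.symm]
  have d1 : (q₁.den : ℝ) ≠ 0 := by exact_mod_cast q₁.den_ne_zero
  have d2 : (q₂.den : ℝ) ≠ 0 := by exact_mod_cast q₂.den_ne_zero
  have e1 : (q₁.num : ℝ) = q₁ * q₁.den := by exact_mod_cast (Rat.mul_den_eq_num q₁).symm
  have e2 : (q₂.num : ℝ) = q₂ * q₂.den := by exact_mod_cast (Rat.mul_den_eq_num q₂).symm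
  have hsh : ∀ m, shell m (fun j => (k j : ℝ)) = 4 * κ (idx m) := fun m => by
    simp only [shell, sum_eq_idx n, k, κ1, κ2, κ0]
    push_cast
    ring
  refine ⟨k, by rw [hsh, κ0]; simp, ?_, ?_⟩
  · rw [hsh, κ1]
    have : (q₂ : ℝ) ≠ 0 := by exact_mod_cast hq₂0
    simp only [A, Int.cast_mul, e2, Int.cast_natCast]
    positivity
  · have f1 : (c + Finsupp.single (n - 1) (q₁ - y₁) + Finsupp.single (n - 2) (q₂ - y₂)) (n - 1) =
        c (n - 1) + (q₁ - y₁) := by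
      simp
    have f2 : (c + Finsupp.single (n - 1) (q₁ - y₁) + Finsupp.single (n - 2) (q₂ - y₂)) (n - 2) =
        c (n - 2) + (q₂ - y₂) := by
      simp
    rw [rate, hsh, hsh, κ1, κ2, f1, f2, sum_eq_idx n]
    simp only [k, κ1, κ2, κ0, y₁, y₂, sum_eq_idx n w]
    simp only [A, B]
    push_cast
    rw [e1, e2]
    ring

end Shells

section Stage

/-- The open region of action space off the coordinate hyperplanes and the walls `r₃ = 2 ^ m`. -/
def actReg : Set (Fin 3 → ℝ) := {r | (∀ i, 0 < r i) ∧ ∀ m : ℤ, r 2 ≠ 2 ^ m}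

lemma isOpen_actReg : IsOpen actReg := by
  rw [isOpen_iff_mem_nhds]
  rintro r ⟨hr, hm⟩
  obtain ⟨n, hn, hn'⟩ := exists_mem_Ico_zpow (hr 2) (one_lt_two (α := ℝ))
  have h1 : ∀ᶠ s : Fin 3 → ℝ in 𝓝 r, ∀ i, 0 < s i :=
    eventually_all.2 fun i => (continuous_apply i).continuousAt.eventually (lt_mem_nhds (hr i))
  have h2 : ∀ᶠ s : Fin 3 → ℝ in 𝓝 r, s 2 ∈ Ioo ((2 : ℝ) ^ n) (2 ^ (n + 1)) :=
    (continuous_apply 2).continuousAt.eventually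
      (Ioo_mem_nhds (lt_of_le_of_ne hn (hm n).symm) hn')
  filter_upwards [h1, h2] with s hs hs'
  refine ⟨hs, fun m h => ?_⟩
  rw [h] at hs'
  have a := (zpow_lt_zpow_iff_right₀ (one_lt_two (α := ℝ))).1 hs'.1
  have b := (zpow_lt_zpow_iff_right₀ (one_lt_two (α := ℝ))).1 hs'.2
  lia

/-- A symplectomorphism supported over a compact part of the regular region. -/
structure StageMap (e : Ph 3 ≃ Ph 3) : Prop where
  symp : IsSymplecto e
  supp : ∃ K, IsCompact K ∧ K ⊆ actReg ∧ ∀ z, act z ∉ K → e z = z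

lemma StageMap.refl : StageMap (Equiv.refl _) :=
  ⟨IsSymplecto.refl, ∅, isCompact_empty, empty_subset _, fun _ _ => rfl⟩

lemma StageMap.trans {e e' : Ph 3 ≃ Ph 3} (h : StageMap e) (h' : StageMap e') :
    StageMap (e.trans e') := by
  obtain ⟨K, hK, hK', he⟩ := h.supp
  obtain ⟨L, hL, hL', he'⟩ := h'.supp
  refine ⟨h.symp.trans h'.symp, K ∪ L, hK.union hL, union_subset hK' hL', fun z hz => ?_⟩
  rw [Equiv.trans_apply, he z fun h => hz (Or.inl h), he' z fun h => hz (Or.inr h)]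

lemma StageMap.apply_eq {e : Ph 3 ≃ Ph 3} (h : StageMap e) {z : Ph 3} (hz : act z ∉ actReg) :
    e z = z := by
  obtain ⟨K, -, hK', he⟩ := h.supp
  exact he z fun h => hz (hK' h)

lemma StageMap.symm_apply_eq {e : Ph 3 ≃ Ph 3} (h : StageMap e) {z : Ph 3}
    (hz : act z ∉ actReg) : e.symm z = z :=
  (Equiv.symm_apply_eq e).2 (h.apply_eq hz).symm

lemma StageMap.act_mem {e : Ph 3 ≃ Ph 3} (h : StageMap e) {z : Ph 3} (hz : act z ∈ actReg) :
    act (e z) ∈ actReg := by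
  by_contra hc
  rw [e.injective (h.apply_eq hc)] at hc
  exact hc hz

lemma zero_notMem_actReg : act (0 : Ph 3) ∉ actReg := fun h => by
  have := h.1 0
  simp [act_apply] at this

lemma StageMap.eventually_eq {e : Ph 3 ≃ Ph 3} (h : StageMap e) : ∀ᶠ z in 𝓝 0, e z = z := by
  obtain ⟨K, hK, hK', he⟩ := h.supp
  have : ∀ᶠ z : Ph 3 in 𝓝 0, act z ∈ Kᶜ :=
    continuous_act.continuousAt.eventually
      (hK.isClosed.isOpen_compl.mem_nhds fun h => zero_notMem_actReg (hK' h))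
  exact this.mono he

variable (w : Fin 3 → ℝ)

/-- The Hamiltonian of a stage. -/
def ham (c : ℤ →₀ ℝ) (e : Ph 3 ≃ Ph 3) (p : Ph 3) : ℝ := intHam w c (act (e p))

/-- The orbits of the Hamiltonian of a stage. -/
def curve (c : ℤ →₀ ℝ) (e : Ph 3 ≃ Ph 3) (p : Ph 3) (t : ℝ) : Ph 3 :=
  e.symm (rot (t • freq (intHam w c) (act (e p))) (e p))

@[simp] lemma curve_zero (c : ℤ →₀ ℝ) (e : Ph 3 ≃ Ph 3) (p : Ph 3) : curve w c e p 0 = p := by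
  simp [curve]

lemma hasDerivAt_curve (c : ℤ →₀ ℝ) {e : Ph 3 ≃ Ph 3} (he : StageMap e) (p : Ph 3) (t : ℝ) :
    HasDerivAt (curve w c e p) (hamVF (ham w c e) (curve w c e p t)) t := by
  have hd : Differentiable ℝ (intHam w c) := (contDiff_intHam w c).differentiable (by simp)
  exact he.symp.hasDerivAt_symm_comp
    (hd.comp ((contDiff_act (n := 1)).differentiable (by simp))) (hasDerivAt_rot hd (e p) t)

lemma act_curve (c : ℤ →₀ ℝ) {e : Ph 3 ≃ Ph 3} (he : StageMap e) {p : Ph 3}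
    (hp : act p ∉ actReg) (t : ℝ) : act (curve w c e p t) = act p := by
  rw [curve, he.apply_eq hp, he.symm_apply_eq (by rwa [act_rot]), act_rot]

lemma contDiff_ham (c : ℤ →₀ ℝ) {e : Ph 3 ≃ Ph 3} (he : StageMap e) : ContDiff ℝ ∞ (ham w c e) :=
  (contDiff_intHam w c).comp (contDiff_act.comp he.symp.contDiff)

/-- The perturbation associated with the `m`-th localised shell function. -/
def pert (m : ℤ) (e : Ph 3 ≃ Ph 3) (p : Ph 3) : ℝ := prof m (shell m (act (e p)))

lemma contDiff_pert (m : ℤ) {e : Ph 3 ≃ Ph 3} (he : StageMap e) : ContDiff ℝ ∞ (pert m e) :=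
  (contDiff_prof m).comp ((contDiff_shell m).comp (contDiff_act.comp he.symp.contDiff))

lemma pert_eventually_eq (m : ℤ) {e : Ph 3 ≃ Ph 3} (he : StageMap e) :
    pert m e =ᶠ[𝓝 0] fun _ => 0 := by
  have h0 : shell m (act (0 : Ph 3)) = 0 := by simp [shell, act_apply]
  have : ∀ᶠ z : Ph 3 in 𝓝 0, shell m (act z) < scale m :=
    ((contDiff_shell m).continuous.comp continuous_act).continuousAt.eventually
      (gt_mem_nhds (by simpa [h0] using scale_pos m))
  filter_upwards [he.eventually_eq, this] with z hz hz'
  rw [pert, hz, prof_eq_zero (Or.inl hz'.le)]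

lemma isCompact_shell_le (m : ℤ) (R : ℝ) :
    IsCompact {r : Fin 3 → ℝ | (∀ i, 0 ≤ r i) ∧ shell m r ≤ R} := by
  refine (isCompact_Icc (a := (0 : Fin 3 → ℝ)) (b := fun _ => R)).of_isClosed_subset ?_ ?_
  · exact (isClosed_Ici (a := (0 : Fin 3 → ℝ))).inter
      (isClosed_le (contDiff_shell m).continuous continuous_const)
  · exact fun r hr => ⟨hr.1, fun j => (le_shell m hr.1 j).trans hr.2⟩

lemma hasCompactSupport_pert (m : ℤ) {e : Ph 3 ≃ Ph 3} (he : StageMap e) :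
    HasCompactSupport (pert m e) := by
  refine HasCompactSupport.of_support_subset_isCompact (K := e.symm '' (act ⁻¹' _))
    ((isCompact_preimage_act (isCompact_shell_le m (2 * scale (m + 3)))).image
      he.symp.contDiff_symm.continuous) fun z hz => ?_
  refine ⟨e z, ⟨fun i => act_nonneg _ i, ?_⟩, e.symm_apply_apply z⟩
  by_contra hc
  exact hz (prof_eq_zero (Or.inr (not_le.1 hc).le))

lemma exists_bound_pert (m : ℤ) {e : Ph 3 ≃ Ph 3} (he : StageMap e) (J : ℕ) :
    ∃ B, 0 < B ∧ ∀ k ≤ J, ∀ p, ‖iteratedFDeriv ℝ k (pert m e) p‖ ≤ B := by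
  have : ∀ k : ℕ, ∃ B, ∀ p, ‖iteratedFDeriv ℝ k (pert m e) p‖ ≤ B := fun k =>
    ((hasCompactSupport_pert m he).iteratedFDeriv k).exists_bound_of_continuous
      ((contDiff_pert m he).continuous_iteratedFDeriv (by exact_mod_cast le_top))
  choose B hB using this
  refine ⟨∑ k ∈ Finset.range (J + 1), |B k| + 1, by positivity, fun k hk p => ?_⟩
  have := Finset.single_le_sum (f := fun k => |B k|) (fun i _ => abs_nonneg _)
    (Finset.mem_range.2 (Nat.lt_succ_of_le hk))
  have h2 := (hB k p).trans (le_abs_self _)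
  linarith

/-- A smooth function which is small with `J` derivatives and flat at the origin. -/
structure IsSmall (J : ℕ) (ε : ℝ) (D : Ph 3 → ℝ) : Prop where
  contDiff : ContDiff ℝ ∞ D
  flat : D =ᶠ[𝓝 0] fun _ => 0
  bound : ∀ k ≤ J, ∀ p, ‖iteratedFDeriv ℝ k D p‖ ≤ ε

lemma IsSmall.add {J : ℕ} {ε ε' : ℝ} {D D' : Ph 3 → ℝ} (h : IsSmall J ε D)
    (h' : IsSmall J ε' D') : IsSmall J (ε + ε') (fun p => D p + D' p) where
  contDiff := h.contDiff.add h'.contDiff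
  flat := by
    filter_upwards [h.flat, h'.flat] with z hz hz'
    rw [hz, hz', add_zero]
  bound k hk p := by
    have e : iteratedFDeriv ℝ k (fun p => D p + D' p) p =
        iteratedFDeriv ℝ k D p + iteratedFDeriv ℝ k D' p :=
      congrFun (fun_iteratedFDeriv_add (h.contDiff.of_le (by exact_mod_cast le_top))
        (h'.contDiff.of_le (by exact_mod_cast le_top))) p
    rw [e]
    exact (norm_add_le _ _).trans (add_le_add (h.bound k hk p) (h'.bound k hk p))

lemma exists_isSmall_pert (m : ℤ) {e : Ph 3 ≃ Ph 3} (he : StageMap e) (J : ℕ) {ε : ℝ}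
    (hε : 0 < ε) : ∃ η, 0 < η ∧ ∀ δ, |δ| ≤ η → IsSmall J ε (fun p => δ * pert m e p) := by
  obtain ⟨B, hB, hb⟩ := exists_bound_pert m he J
  refine ⟨ε / B, by positivity, fun δ hδ => ⟨contDiff_const.mul (contDiff_pert m he), ?_, ?_⟩⟩
  · filter_upwards [pert_eventually_eq m he] with z hz
    rw [hz, mul_zero]
  · intro k hk p
    have e : iteratedFDeriv ℝ k (fun p => δ * pert m e p) p =
        δ • iteratedFDeriv ℝ k (pert m e) p :=
      iteratedFDeriv_const_smul_apply (a := δ) (f := pert m e)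
        ((contDiff_pert m he).of_le (by exact_mod_cast le_top)).contDiffAt
    rw [e, norm_smul, Real.norm_eq_abs]
    calc |δ| * _ ≤ ε / B * B := by gcongr; exact hb k hk p
      _ = ε := by field_simp

lemma ham_add_single (c : ℤ →₀ ℝ) (m : ℤ) (a : ℝ) (e : Ph 3 ≃ Ph 3) (p : Ph 3) :
    ham w (c + Finsupp.single m a) e p = ham w c e p + a * pert m e p :=
  intHam_add_single w c m a _

end Stage

section StageStep

/-- The part of the `n`-th shell of the regular region at distance at least `η` from the walls. -/
def shellCore (n : ℤ) (η : ℝ) : Set (Fin 3 → ℝ) :=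
  {r | (∀ i, η ≤ r i) ∧ (∀ m : ℤ, η ≤ |r 2 - 2 ^ m|) ∧ scale n / 8 ≤ shell n r ∧
    shell n r ≤ 16 * scale n}

lemma isCompact_shellCore (n : ℤ) {η : ℝ} (hη : 0 < η) : IsCompact (shellCore n η) := by
  refine (isCompact_shell_le n (16 * scale n)).of_isClosed_subset ?_
    fun r hr => ⟨fun i => hη.le.trans (hr.1 i), hr.2.2.2⟩
  have hs := (contDiff_shell n).continuous
  refine IsClosed.inter (isClosed_Ici (a := fun _ : Fin 3 => η)) (IsClosed.inter ?_
    ((isClosed_le continuous_const hs).inter (isClosed_le hs continuous_const)))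
  have : IsClosed {r : Fin 3 → ℝ | ∀ m : ℤ, η ≤ |r 2 - 2 ^ m|} := by
    simp only [ofPred_forall]
    exact isClosed_iInter fun m => isClosed_le continuous_const
      ((continuous_apply 2).sub continuous_const).abs
  exact this

lemma shellCore_subset (n : ℤ) {η : ℝ} (hη : 0 < η) : shellCore n η ⊆ annulus n ∩ actReg := by
  rintro r ⟨h1, h2, h3, h4⟩
  have hp := scale_pos n
  refine ⟨⟨by linarith, by linarith⟩, fun i => hη.trans_le (h1 i), fun m hm => ?_⟩
  have := h2 m
  rw [hm, sub_self, abs_zero] at this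
  linarith

lemma segment_subset_shellCore (n : ℤ) {η : ℝ} {a b : Fin 3 → ℝ} (ha : a ∈ shellCore n η)
    (hb : b ∈ shellCore n η) (hab : segment ℝ a b ⊆ annulus n ∩ actReg) :
    segment ℝ a b ⊆ shellCore n η := by
  obtain ⟨a1, a2, a3, a4⟩ := ha
  obtain ⟨b1, b2, b3, b4⟩ := hb
  have hsh : ∀ u v : ℝ, shell n (u • a + v • b) = u * shell n a + v * shell n b := by
    intro u v
    simp only [shell, Pi.add_apply, Pi.smul_apply, smul_eq_mul, Finset.sum_add_distrib,
      ← Finset.mul_sum]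
    ring
  have hno : ∀ m : ℤ, ∀ u v : ℝ, 0 ≤ u → 0 ≤ v → u + v = 1 → u * a 2 + v * b 2 ≠ 2 ^ m :=
    fun m u v hu hv huv => (hab ⟨u, v, hu, hv, huv, rfl⟩).2.2 m
  rintro _ ⟨u, v, hu, hv, huv, rfl⟩
  obtain rfl : v = 1 - u := by linarith
  refine ⟨fun i => ?_, fun m => ?_, ?_, ?_⟩
  · simp only [Pi.add_apply, Pi.smul_apply, smul_eq_mul]
    nlinarith [a1 i, b1 i]
  · simp only [Pi.add_apply, Pi.smul_apply, smul_eq_mul]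
    have hcross : (a 2 - 2 ^ m) * (b 2 - 2 ^ m) ≤ 0 → a 2 = b 2 → a 2 = 2 ^ m := by
      intro h h'
      rw [← h'] at h
      nlinarith [sq_nonneg (a 2 - 2 ^ m)]
    have hside : 0 < (a 2 - 2 ^ m) * (b 2 - 2 ^ m) := by
      by_contra! hc
      by_cases he : a 2 = b 2
      · exact hno m 1 0 zero_le_one le_rfl (by norm_num)
          (by rw [one_mul, zero_mul, add_zero]; exact hcross hc he)
      · have hne : a 2 - b 2 ≠ 0 := sub_ne_zero.2 he
        refine hno m ((2 ^ m - b 2) / (a 2 - b 2)) ((a 2 - 2 ^ m) / (a 2 - b 2)) ?_ ?_ ?_ ?_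
        · rw [div_nonneg_iff]
          rcases lt_or_gt_of_ne hne with h | h
          · right; constructor <;> nlinarith
          · left; constructor <;> nlinarith
        · rw [div_nonneg_iff]
          rcases lt_or_gt_of_ne hne with h | h
          · right; constructor <;> nlinarith
          · left; constructor <;> nlinarith
        · field_simp; ring
        · field_simp; ring
    have ha := a2 m
    have hb := b2 m
    rcases pos_and_pos_or_neg_and_neg_of_mul_pos hside with ⟨h1, h2⟩ | ⟨h1, h2⟩
    · rw [abs_of_pos h1] at ha
      rw [abs_of_pos h2] at hb
      exact le_trans (by nlinarith) (le_abs_self _)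
    · rw [abs_of_neg h1] at ha
      rw [abs_of_neg h2] at hb
      exact le_trans (by nlinarith) (neg_le_abs _)
  · rw [hsh]; nlinarith
  · rw [hsh]; nlinarith

lemma exists_subset_shellCore {Q : Set (Fin 3 → ℝ)} (hQ : IsCompact Q) (hQ' : Q ⊆ actReg) :
    ∃ η, 0 < η ∧ ∀ n, ∀ r ∈ Q, scale n / 8 ≤ shell n r → shell n r ≤ 16 * scale n →
      r ∈ shellCore n η := by
  obtain ⟨η, hη, h⟩ := hQ.exists_thickening_subset_open isOpen_actReg hQ'
  have key : ∀ r ∈ Q, ∀ i x, Function.update r i x ∉ actReg → η ≤ |r i - x| := by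
    intro r hr i x hx
    by_contra! hc
    refine hx (h (mem_thickening_iff.2 ⟨r, hr, (dist_pi_lt_iff hη).2 fun j => ?_⟩))
    by_cases hj : j = i
    · subst hj; rwa [Function.update_self, dist_comm, Real.dist_eq]
    · rwa [Function.update_of_ne hj, dist_self]
  refine ⟨η, hη, fun n r hr h1 h2 => ⟨fun i => ?_, fun m => ?_, h1, h2⟩⟩
  · have := key r hr i 0 fun h => by simpa using h.1 i
    rwa [sub_zero, abs_of_pos ((hQ' hr).1 i)] at this
  · exact key r hr 2 _ fun h => h.2 m (Function.update_self _ _ _)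

/-- Two action vectors are related by a rearrangement inside the `n`-th shell. -/
def ShellRel (n : ℤ) (r r' : Fin 3 → ℝ) : Prop :=
  r' = r ∨ r ∈ annulus n ∧ r' ∈ annulus n ∧ (∀ i, 0 < r i) ∧ (∀ i, 0 < r' i) ∧
    shell n r' = shell n r

/-- A small modification of a stage makes every orbit in the `n`-th shell leave a given compact
part of the regular region. -/
lemma exists_stage (w : Fin 3 → ℝ) (c : ℤ →₀ ℝ) {e : Ph 3 ≃ Ph 3} (he : StageMap e) (n : ℤ)
    {K : Set (Ph 3)} (hK : IsCompact K) (hK' : ∀ z ∈ K, act z ∈ actReg) (J : ℕ) {ε : ℝ}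
    (hε : 0 < ε) : ∃ (c' : ℤ →₀ ℝ) (e' : Ph 3 ≃ Ph 3) (T : ℝ), StageMap e' ∧ 0 ≤ T ∧
      IsSmall J ε (fun p => ham w c' e' p - ham w c e p) ∧
      (∀ p, ShellRel n (act (e p)) (act (e' p))) ∧
      ∀ p, act p ∈ actReg → scale n / 8 ≤ shell n (act (e' p)) →
        shell n (act (e' p)) ≤ 16 * scale n → ∃ t ∈ Icc 0 T, curve w c' e' p t ∉ K := by
  obtain ⟨η₁, hη₁, hs₁⟩ := exists_isSmall_pert (n - 1) he J (show 0 < ε / 3 by positivity)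
  obtain ⟨η₂, hη₂, hs₂⟩ := exists_isSmall_pert (n - 2) he J (show 0 < ε / 3 by positivity)
  obtain ⟨δ₁, δ₂, hδ₁, hδ₂, k, hk0, hk1, hrate⟩ := exists_resonance w c n (lt_min hη₁ hη₂)
  set c₁ : ℤ →₀ ℝ := c + Finsupp.single (n - 1) δ₁ + Finsupp.single (n - 2) δ₂
  have hk : k ≠ 0 := fun h => hk1 (by simp [h, shell])
  have hQ : IsCompact (act '' (e '' K)) :=
    (hK.image he.symp.contDiff.continuous).image continuous_act
  obtain ⟨η, hη, hcore⟩ := exists_subset_shellCore hQ (by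
    rintro _ ⟨_, ⟨z, hz, rfl⟩, rfl⟩
    exact he.act_mem (hK' z hz))
  obtain ⟨g, hg, ⟨Kg, hKg, hKgU, hgK⟩, hgk, hex⟩ := exists_push hk
    ((isOpen_annulus n).inter isOpen_actReg) (fun r hr => hr.2.1) (isCompact_shellCore n hη)
    (shellCore_subset n hη) (fun a ha b hb => segment_subset_shellCore n ha hb)
  have hgS : StageMap g := ⟨hg, Kg, hKg, hKgU.trans inter_subset_right, hgK⟩
  have hg1 : ∀ z, g z = z ∨ act z ∈ annulus n ∩ actReg ∧ act (g z) ∈ annulus n ∩ actReg := by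
    intro z
    by_cases h1 : act z ∈ Kg
    · by_cases h2 : act (g z) ∈ Kg
      · exact Or.inr ⟨hKgU h1, hKgU h2⟩
      · exact Or.inl (g.injective (hgK _ h2))
    · exact Or.inl (hgK _ h1)
  have hgsh : ∀ z, shell n (act (g z)) = shell n (act z) := fun z => by
    obtain ⟨s, hs⟩ := hgk z
    rw [hs, shell_add_smul, hk0, mul_zero, add_zero]
  have hgham : ∀ z, intHam w c₁ (act (g z)) = intHam w c₁ (act z) := fun z => by
    rcases hg1 z with h | ⟨h, -⟩
    · rw [h]
    · obtain ⟨s, hs⟩ := hgk z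
      rw [hs, intHam_add_smul w c₁ (fun j => act_nonneg z j) h.1 hk0
        (fun j => by rw [← hs]; exact act_nonneg _ j), hrate, mul_zero, add_zero]
  set e' := e.trans g
  have he' : StageMap e' := he.trans hgS
  obtain ⟨δ, hδ, hs₃⟩ := exists_isSmall_pert (n - 1) he' J (show 0 < ε / 3 by positivity)
  set α := δ * shell (n - 1) fun j => (k j : ℝ)
  have hα : α ≠ 0 := mul_ne_zero hδ.ne' hk1
  refine ⟨c₁ + Finsupp.single (n - 1) δ, e', 2 * Real.pi / |α|, he', by positivity, ?_,
    fun p => ?_, fun p hp hlo hhi => ?_⟩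
  · have h := ((hs₁ δ₁ (hδ₁.trans (min_le_left _ _))).add
      (hs₂ δ₂ (hδ₂.trans (min_le_right _ _)))).add (hs₃ δ (abs_of_pos hδ).le)
    have h1 : ∀ p, ham w c₁ e' p = ham w c₁ e p := fun p => hgham (e p)
    convert h using 1
    · ring
    · ext p
      rw [ham_add_single, h1, ham_add_single, ham_add_single]
      ring
  · rcases hg1 (e p) with h | ⟨h, h'⟩
    · exact Or.inl (congrArg act h)
    · exact Or.inr ⟨h.1, h'.1, h.2.1, h'.2.1, hgsh _⟩
  · set f := freq (intHam w (c₁ + Finsupp.single (n - 1) δ)) (act (e' p))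
    have hreg := he'.act_mem hp
    have hann : act (e' p) ∈ annulus n := by
      have := scale_pos n
      exact ⟨by linarith, by linarith⟩
    have hf : ∑ j, k j * f j = α := by
      rw [sum_mul_freq _ _ (fun j => (k j : ℝ)), fderiv_intHam _ _ hreg.1 hann hk0]
      have h1 : (c₁ + Finsupp.single (n - 1) δ) (n - 1) = c₁ (n - 1) + δ := by simp
      have h2 : (c₁ + Finsupp.single (n - 1) δ) (n - 2) = c₁ (n - 2) := by simp
      rw [rate] at hrate ⊢
      rw [h1, h2]
      linear_combination hrate
    obtain ⟨⟨t₁, ht₁, him₁, hre₁⟩, t₂, ht₂, him₂, hre₂⟩ :=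
      exists_mono_rot_real k (mono_ne_zero k hreg.1) hα hf
    have hin : ∀ t, curve w (c₁ + Finsupp.single (n - 1) δ) e' p t ∈ K →
        act (g.symm (rot (t • f) (e' p))) ∈ shellCore n η := by
      intro t ht
      have h1 : shell n (act (g.symm (rot (t • f) (e' p)))) = shell n (act (e' p)) := by
        rw [← hgsh, g.apply_symm_apply, act_rot]
      refine hcore n _ ⟨_, ⟨_, ht, ?_⟩, rfl⟩ (by rwa [h1]) (by rwa [h1])
      simp only [curve, e', Equiv.symm_trans_apply, Equiv.apply_symm_apply]
      rfl
    by_contra! hc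
    exact hex _ _ (by rw [act_rot, act_rot]) (by rw [act_rot]; exact ⟨hann, hreg⟩) him₁ hre₁
      him₂ hre₂ ⟨hin t₁ (hc t₁ ht₁), hin t₂ (hc t₂ ht₂)⟩

end StageStep

section Flow
variable {E : Type*} [NormedAddCommGroup E] [NormedSpace ℝ E]

lemma exists_global_integralCurve [CompleteSpace E] {v : E → E} {K : NNReal} (hv : ContDiff ℝ 1 v)
    (hK : LipschitzWith K v) (x : E) : ∃ γ : ℝ → E, γ 0 = x ∧ ∀ t, HasDerivAt γ (v (γ t)) t := by
  set ε : ℝ := 1 / (2 * (K + 1))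
  have hε : 0 < ε := by positivity
  have hloc : ∀ x : E, ∃ γ : ℝ → E, γ 0 = x ∧ IsMIntegralCurveOn (I := modelWithCornersSelf ℝ E)
      γ v (Ioo (-ε) ε) := by
    intro x
    have hp : IsPicardLindelof (fun _ => v) (tmin := -ε) (tmax := ε)
        ⟨0, ⟨by linarith, hε.le⟩⟩ x ‖v x‖₊ 0 (‖v x‖₊ + K * ‖v x‖₊) K := by
      refine ⟨fun _ _ => hK.lipschitzOnWith, fun _ _ => continuousOn_const, fun _ _ y hy => ?_, ?_⟩
      · have h1 := hK.dist_le_mul y x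
        rw [mem_closedBall] at hy
        have h2 : ‖v y‖ ≤ dist (v y) (v x) + ‖v x‖ := by
          rw [dist_eq_norm]; simpa using norm_add_le (v y - v x) (v x)
        have h3 : (K : ℝ) * dist y x ≤ K * ‖v x‖ := by gcongr; exact hy
        push_cast
        linarith
      · simp only [sub_zero, zero_sub, neg_neg, max_self, NNReal.coe_zero]
        push_cast
        simp only [ε]
        rw [mul_one_div, div_le_iff₀ (by positivity)]
        nlinarith [norm_nonneg (v x), mul_nonneg K.coe_nonneg (norm_nonneg (v x))]
    obtain ⟨γ, h0, hγ⟩ := hp.exists_eq_forall_mem_Icc_hasDerivWithinAt₀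
    refine ⟨γ, h0, fun t ht => ?_⟩
    exact ((hγ t (Ioo_subset_Icc_self ht)).mono
      Ioo_subset_Icc_self).hasFDerivWithinAt.hasMFDerivWithinAt
  obtain ⟨γ, h0, hγ⟩ := exists_isMIntegralCurve_of_isMIntegralCurveOn
    (contMDiff_vectorSpace_iff_contDiff.2 hv) hε hloc x
  refine ⟨γ, h0, fun t => ?_⟩
  have h : HasFDerivAt γ ((1 : ℝ →L[ℝ] ℝ).smulRight (v (γ t))) t := (hγ t).hasFDerivAt
  simpa using h.hasDerivAt

lemma exists_global_flow [CompleteSpace E] {v : E → E} {K : NNReal} (hv : ContDiff ℝ 1 v)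
    (hK : LipschitzWith K v) : ∃ Φ : ℝ → E → E, (∀ p, Φ 0 p = p) ∧
      (∀ s t p, Φ (s + t) p = Φ s (Φ t p)) ∧
      ∀ p t, HasDerivAt (fun τ => Φ τ p) (v (Φ t p)) t := by
  choose γ h0 hγ using exists_global_integralCurve hv hK
  refine ⟨fun t p => γ p t, h0, fun s t p => ?_, hγ⟩
  have := ODE_solution_unique_univ (v := fun _ => v) (s := fun _ => univ) (K := K)
    (f := fun s => γ p (s + t)) (g := γ (γ p t)) (t₀ := 0) (fun _ => hK.lipschitzOnWith)
    (fun s => ⟨(hγ p (s + t)).comp_add_const s t, mem_univ _⟩) (fun s => ⟨hγ _ s, mem_univ _⟩)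
    (by simp [h0])
  exact congrFun this s

/-- Integral curves of close vector fields stay close. -/
lemma dist_integralCurve_le {v u : E → E} {K : NNReal} (hK1 : 1 ≤ K) (hK : LipschitzWith K v)
    {ε : ℝ} (hε : ∀ z, ‖u z - v z‖ ≤ ε) {f g : ℝ → E} (hf : ∀ t, HasDerivAt f (v (f t)) t)
    (hg : ∀ t, HasDerivAt g (u (g t)) t) (h0 : f 0 = g 0) {t : ℝ} (ht : 0 ≤ t) :
    dist (f t) (g t) ≤ ε * Real.exp (K * t) := by
  have h := dist_le_of_approx_trajectories_ODE (v := fun _ => v) (f' := fun t => v (f t))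
    (g' := fun t => u (g t)) (εf := 0) (εg := ε) (δ := 0) (a := 0) (b := t) (fun _ => hK)
    (fun s _ => (hf s).continuousAt.continuousWithinAt) (fun s _ => (hf s).hasDerivWithinAt)
    (by simp) (fun s _ => (hg s).continuousAt.continuousWithinAt)
    (fun s _ => (hg s).hasDerivWithinAt) (fun s _ => by rw [dist_eq_norm]; exact hε _)
    (by simp [h0]) t ⟨ht, le_rfl⟩
  have hε0 : 0 ≤ ε := (norm_nonneg _).trans (hε 0)
  have hK' : (1 : ℝ) ≤ K := by exact_mod_cast hK1
  rw [gronwallBound_of_K_ne_0 (by positivity)] at h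
  simp only [zero_mul, zero_add, sub_zero] at h
  refine h.trans ?_
  have := Real.exp_pos (K * t)
  calc ε / K * (Real.exp (K * t) - 1) ≤ ε * (Real.exp (K * t) - 1) := by
        gcongr
        · rw [sub_nonneg]; exact Real.one_le_exp (by positivity)
        · exact div_le_self hε0 hK'
    _ ≤ _ := by gcongr; linarith

end Flow

section Series

lemma IsSmall.mono {J J' : ℕ} {ε : ℝ} {D : Ph 3 → ℝ} (h : IsSmall J ε D) (hJ : J' ≤ J) :
    IsSmall J' ε D :=
  ⟨h.contDiff, h.flat, fun k hk => h.bound k (hk.trans hJ)⟩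

variable {D : ℕ → Ph 3 → ℝ} {ε : ℕ → ℝ}

lemma le_geometric (hε : ∀ i, ε (i + 1) ≤ ε i / 2) (i : ℕ) : ε i ≤ ε 0 * (1 / 2) ^ i := by
  induction i with
  | zero => simp
  | succ i ih => rw [pow_succ]; linarith [hε i]

lemma contDiff_tsum_small (hD : ∀ i, IsSmall (i + 2) (ε i) (D i))
    (hε : ∀ i, ε (i + 1) ≤ ε i / 2) : ContDiff ℝ ∞ (fun p => ∑' i, D i p) := by
  refine contDiff_tsum_of_eventually (v := fun _ i => ε 0 * (1 / 2) ^ i)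
    (fun i => (hD i).contDiff) (fun _ _ => summable_geometric_two.mul_left _) fun k _ => ?_
  rw [Nat.cofinite_eq_atTop]
  filter_upwards [eventually_ge_atTop k] with i hi p
  exact ((hD i).bound k (by lia) p).trans (le_geometric hε i)

lemma iteratedFDeriv_tsum_small (hD : ∀ i, IsSmall (i + 2) (ε i) (D i))
    (hε : ∀ i, ε (i + 1) ≤ ε i / 2) {k : ℕ} (hk : k ≤ 2) (p : Ph 3) :
    iteratedFDeriv ℝ k (fun p => ∑' i, D i p) p = ∑' i, iteratedFDeriv ℝ k (D i) p :=
  iteratedFDeriv_tsum_apply (N := 2) (v := fun _ i => ε 0 * (1 / 2) ^ i)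
    (fun i => (hD i).contDiff.of_le (by exact_mod_cast le_top))
    (fun _ _ => summable_geometric_two.mul_left _)
    (fun k i p hk => ((hD i).bound k (by have : k ≤ 2 := by exact_mod_cast hk
                                         lia) p).trans (le_geometric hε i))
    (by exact_mod_cast hk) p

lemma norm_iteratedFDeriv_tsum_small_le (hD : ∀ i, IsSmall (i + 2) (ε i) (D i))
    (hε : ∀ i, ε (i + 1) ≤ ε i / 2) {k : ℕ} (hk : k ≤ 2) (p : Ph 3) :
    ‖iteratedFDeriv ℝ k (fun p => ∑' i, D i p) p‖ ≤ 2 * ε 0 := by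
  rw [iteratedFDeriv_tsum_small hD hε hk]
  refine tsum_of_norm_bounded ?_ fun i =>
    ((hD i).bound k (by lia) p).trans (le_geometric hε i)
  rw [mul_comm]
  exact hasSum_geometric_two.mul_left _

lemma iteratedFDeriv_tsum_small_zero (hD : ∀ i, IsSmall (i + 2) (ε i) (D i))
    (hε : ∀ i, ε (i + 1) ≤ ε i / 2) {k : ℕ} (hk : k ≤ 2) :
    iteratedFDeriv ℝ k (fun p => ∑' i, D i p) 0 = 0 := by
  rw [iteratedFDeriv_tsum_small hD hε hk]
  have : ∀ i, iteratedFDeriv ℝ k (D i) 0 = 0 := fun i => by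
    rw [((hD i).flat.iteratedFDeriv ℝ k).eq_of_nhds]
    simp
  simp [this]

lemma summable_small (hD : ∀ i, IsSmall (i + 2) (ε i) (D i)) (hε : ∀ i, ε (i + 1) ≤ ε i / 2)
    (p : Ph 3) : Summable fun i => D i p :=
  (summable_geometric_two.mul_left (ε 0)).of_norm_bounded fun i => by
    have := ((hD i).bound 0 (by lia) p).trans (le_geometric hε i)
    rwa [norm_iteratedFDeriv_zero] at this

end Series

section Scheme

/-- The action vectors which are moved to the regime of the `n`-th and `(n+1)`-st shells only. -/
def shellClass (n : ℤ) : Set (Fin 3 → ℝ) :=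
  {r | (∀ i, 0 < r i) ∧ scale n ≤ shell n r ∧ shell (n + 1) r < scale (n + 1)}

lemma exists_mem_shellClass {r : Fin 3 → ℝ} (hr : ∀ i, 0 < r i) : ∃ n, r ∈ shellClass n := by
  have hr' := fun i => (hr i).le
  have hs0 : 0 < shell 0 r := (hr 0).trans_le (le_shell 0 hr' 0)
  obtain ⟨a, ha, -⟩ := exists_mem_Ico_zpow (x := shell 0 r / 2) (by positivity)
    (show (1 : ℝ) < 64 by norm_num)
  obtain ⟨b, -, hb⟩ := exists_mem_Ico_zpow (x := 2 * shell 0 r) (by positivity)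
    (show (1 : ℝ) < 64 by norm_num)
  obtain ⟨n, hn, hmax⟩ := Int.exists_greatest_of_bdd (P := fun n => scale n ≤ shell n r)
    ⟨b + 1, fun m hm => by
      by_contra! hc
      have h1 := scale_mono hc.le
      have h2 := shell_le m 0 hr'
      unfold scale at *
      linarith⟩
    ⟨a, by have := shell_le 0 a hr'; unfold scale; linarith⟩
  refine ⟨n, hr, hn, ?_⟩
  by_contra! hc
  have := hmax (n + 1) hc
  lia

lemma ShellRel.mem_shellClass {m n : ℤ} {r r' : Fin 3 → ℝ} (h : ShellRel m r r')
    (hr : r ∈ shellClass n) : r' ∈ shellClass n := by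
  rcases h with rfl | ⟨hm, hm', hp, hp', hs⟩
  · exact hr
  obtain ⟨-, hlo, hhi⟩ := hr
  have h0 : ∀ j, 0 ≤ r j := fun j => (hp j).le
  have h0' : ∀ j, 0 ≤ r' j := fun j => (hp' j).le
  have hn := scale_pos n
  rw [scale_add_one] at hhi
  have hm1 : n ≤ m := by
    by_contra! hc
    have h1 := scale_mono (show m + 1 ≤ n by lia)
    rw [scale_add_one] at h1
    linarith [hm.2, shell_le n m h0]
  have hm2 : m ≤ n + 1 := by
    by_contra! hc
    have h1 := scale_mono (show n + 1 + 1 ≤ m by lia)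
    rw [scale_add_one, scale_add_one] at h1
    linarith [hm.1, shell_le m (n + 1) h0]
  obtain rfl | rfl : m = n ∨ m = n + 1 := by lia
  · refine ⟨hp', by rwa [hs], ?_⟩
    rw [scale_add_one]
    linarith [hm'.2, shell_le (m + 1) m h0']
  · refine ⟨hp', ?_, by rwa [hs, scale_add_one]⟩
    have h1 := hm'.1
    rw [scale_add_one] at h1
    linarith [shell_le (n + 1) n h0']

/-- A sequence of stages converging fast, following the itinerary `ν` and pushing the orbits out of
the sets `Q j`. -/
structure Scheme (w : Fin 3 → ℝ) (L : ℝ) (ν : ℕ → ℤ) (Q : ℕ → Set (Ph 3)) where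
  (c : ℕ → ℤ →₀ ℝ) (e : ℕ → Ph 3 ≃ Ph 3) (ε T : ℕ → ℝ)
  c_zero : c 0 = 0
  e_zero : e 0 = Equiv.refl _
  ε_zero : ε 0 = 1
  ε_pos (j) : 0 < ε j
  stageMap (j) : StageMap (e j)
  T_nonneg (j) : 0 ≤ T j
  isSmall (j) : IsSmall (j + 2) (ε j) (fun p =>
    ham w (c (j + 1)) (e (j + 1)) p - ham w (c j) (e j) p)
  shellRel (j) (p) : ShellRel (ν j) (act (e j p)) (act (e (j + 1) p))
  exit (j) (p) : act p ∈ actReg → scale (ν j) / 8 ≤ shell (ν j) (act (e (j + 1) p)) →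
    shell (ν j) (act (e (j + 1) p)) ≤ 16 * scale (ν j) →
    ∃ t ∈ Icc 0 (T j), curve w (c (j + 1)) (e (j + 1)) p t ∉ Q j
  ε_half (j) : ε (j + 1) ≤ ε j / 2
  ε_le (j) : ε (j + 1) * Real.exp (L * T j) ≤ 1 / (j + 1)

lemma nonempty_scheme (w : Fin 3 → ℝ) (L : ℝ) (ν : ℕ → ℤ) {Q : ℕ → Set (Ph 3)}
    (hQ : ∀ j, IsCompact (Q j)) (hQ' : ∀ j, ∀ z ∈ Q j, act z ∈ actReg) :
    Nonempty (Scheme w L ν Q) := by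
  let σ := {s : (ℤ →₀ ℝ) × (Ph 3 ≃ Ph 3) × ℝ // StageMap s.2.1 ∧ 0 < s.2.2}
  have step : ∀ (j : ℕ) (s : σ), ∃ (s' : σ) (T : ℝ), 0 ≤ T ∧
      IsSmall (j + 2) s.1.2.2 (fun p => ham w s'.1.1 s'.1.2.1 p - ham w s.1.1 s.1.2.1 p) ∧
      (∀ p, ShellRel (ν j) (act (s.1.2.1 p)) (act (s'.1.2.1 p))) ∧
      (∀ p, act p ∈ actReg → scale (ν j) / 8 ≤ shell (ν j) (act (s'.1.2.1 p)) →
        shell (ν j) (act (s'.1.2.1 p)) ≤ 16 * scale (ν j) →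
        ∃ t ∈ Icc 0 T, curve w s'.1.1 s'.1.2.1 p t ∉ Q j) ∧
      s'.1.2.2 ≤ s.1.2.2 / 2 ∧ s'.1.2.2 * Real.exp (L * T) ≤ 1 / (j + 1) := by
    rintro j ⟨⟨c, e, ε⟩, he, hε⟩
    obtain ⟨c', e', T, he', hT, h1, h2, h3⟩ :=
      exists_stage w c he (ν j) (hQ j) (hQ' j) (j + 2) hε
    have hε' : (0 : ℝ) < min (ε / 2) (1 / (j + 1) / Real.exp (L * T)) :=
      lt_min (half_pos hε) (by positivity)
    exact ⟨⟨⟨c', e', _⟩, he', hε'⟩, T, hT, h1, h2, h3, min_le_left _ _,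
      (le_div_iff₀ (Real.exp_pos _)).1 (min_le_right _ _)⟩
  choose F T hT h1 h2 h3 h4 h5 using step
  let s : ℕ → σ := fun j => Nat.rec ⟨⟨0, Equiv.refl _, 1⟩, StageMap.refl, one_pos⟩ F j
  exact ⟨{
    c := fun j => (s j).1.1
    e := fun j => (s j).1.2.1
    ε := fun j => (s j).1.2.2
    T := fun j => T j (s j)
    c_zero := rfl
    e_zero := rfl
    ε_zero := rfl
    ε_pos := fun j => (s j).2.2
    stageMap := fun j => (s j).2.1
    T_nonneg := fun j => hT j (s j)
    isSmall := fun j => h1 j (s j)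
    shellRel := fun j => h2 j (s j)
    exit := fun j => h3 j (s j)
    ε_half := fun j => h4 j (s j)
    ε_le := fun j => h5 j (s j) }⟩

lemma exists_itinerary : ∃ ν : ℕ → ℤ, ∀ n N, ∃ j ≥ N, ν j = n ∧ ν (j + 1) = n + 1 := by
  refine ⟨fun j => Equiv.intEquivNat.symm (Nat.unpair (j / 2)).1 + (j % 2 : ℕ), fun n N => ?_⟩
  have hN := Nat.right_le_pair (Equiv.intEquivNat n) N
  refine ⟨2 * Nat.pair (Equiv.intEquivNat n) N, by lia, by simp, ?_⟩
  beta_reduce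
  rw [show (2 * Nat.pair (Equiv.intEquivNat n) N + 1) / 2 = Nat.pair (Equiv.intEquivNat n) N by lia,
    show (2 * Nat.pair (Equiv.intEquivNat n) N + 1) % 2 = 1 by lia]
  simp

namespace Scheme
variable {w : Fin 3 → ℝ} {L : ℝ} {ν : ℕ → ℤ} {Q : ℕ → Set (Ph 3)} (S : Scheme w L ν Q)

lemma mem_shellClass {p : Ph 3} {n : ℤ} (hp : act p ∈ shellClass n) (j : ℕ) :
    act (S.e j p) ∈ shellClass n := by
  induction j with
  | zero => rwa [S.e_zero]
  | succ j ih => exact (S.shellRel j p).mem_shellClass ih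

lemma exists_exit (hν : ∀ n N, ∃ j ≥ N, ν j = n ∧ ν (j + 1) = n + 1) {p : Ph 3}
    (hp : act p ∈ actReg) (N : ℕ) :
    ∃ j ≥ N, ∃ t ∈ Icc 0 (S.T j), curve w (S.c (j + 1)) (S.e (j + 1)) p t ∉ Q j := by
  obtain ⟨n, hn⟩ := exists_mem_shellClass hp.1
  obtain ⟨j, hj, h1, h2⟩ := hν n N
  obtain ⟨hpos, hlo, hhi⟩ := S.mem_shellClass hn (j + 1)
  have hs := scale_pos n
  by_cases hc : shell n (act (S.e (j + 1) p)) ≤ 16 * scale n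
  · exact ⟨j, hj, S.exit j p hp (by rw [h1]; linarith) (by rwa [h1])⟩
  · push Not at hc
    have h3 := shell_le n (n + 1) fun i => (hpos i).le
    have h4 : shell (n + 1) (act (S.e (j + 1 + 1) p)) = shell (n + 1) (act (S.e (j + 1) p)) := by
      rcases S.shellRel (j + 1) p with h | h
      · rw [h]
      · rw [h2] at h; exact h.2.2.2.2
    refine ⟨j + 1, by lia, S.exit (j + 1) p hp ?_ ?_⟩ <;> rw [h2, h4, scale_add_one]
    · linarith
    · rw [scale_add_one] at hhi
      linarith

/-- The increments of the Hamiltonians. -/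
def incr (j : ℕ) (p : Ph 3) : ℝ :=
  ham w (S.c (j + 1)) (S.e (j + 1)) p - ham w (S.c j) (S.e j) p

/-- The remainder after `j` stages. -/
def rem (j : ℕ) (p : Ph 3) : ℝ := ∑' i, S.incr (i + j) p

/-- The limit Hamiltonian. -/
def limHam (p : Ph 3) : ℝ := ham w (S.c 0) (S.e 0) p + S.rem 0 p

lemma isSmall_incr (j i : ℕ) : IsSmall (i + 2) (S.ε (i + j)) (S.incr (i + j)) :=
  (S.isSmall (i + j)).mono (by lia)

lemma ε_shift (j i : ℕ) : S.ε (i + 1 + j) ≤ S.ε (i + j) / 2 := by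
  rw [show i + 1 + j = i + j + 1 by ring]; exact S.ε_half _

lemma contDiff_rem (j : ℕ) : ContDiff ℝ ∞ (S.rem j) :=
  contDiff_tsum_small (S.isSmall_incr j) (S.ε_shift j)

lemma norm_iteratedFDeriv_rem_le (j : ℕ) {k : ℕ} (hk : k ≤ 2) (p : Ph 3) :
    ‖iteratedFDeriv ℝ k (S.rem j) p‖ ≤ 2 * S.ε j := by
  have := norm_iteratedFDeriv_tsum_small_le (S.isSmall_incr j) (S.ε_shift j) hk p
  rwa [zero_add] at this

lemma iteratedFDeriv_rem_zero (j : ℕ) {k : ℕ} (hk : k ≤ 2) :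
    iteratedFDeriv ℝ k (S.rem j) 0 = 0 :=
  iteratedFDeriv_tsum_small_zero (S.isSmall_incr j) (S.ε_shift j) hk

lemma limHam_eq (j : ℕ) (p : Ph 3) : S.limHam p = ham w (S.c j) (S.e j) p + S.rem j p := by
  induction j with
  | zero => rfl
  | succ j ih =>
    have h := (summable_small (S.isSmall_incr j) (S.ε_shift j) p).tsum_eq_zero_add
    have h2 : ∀ i, S.incr (i + 1 + j) p = S.incr (i + (j + 1)) p := fun i => by
      rw [show i + 1 + j = i + (j + 1) by ring]
    simp only [h2, zero_add] at h
    rw [ih, rem, h, rem, incr]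
    ring

lemma contDiff_limHam : ContDiff ℝ ∞ S.limHam :=
  (contDiff_ham w _ (S.stageMap 0)).add (S.contDiff_rem 0)

lemma hamVF_limHam (j : ℕ) (p : Ph 3) :
    hamVF S.limHam p = hamVF (ham w (S.c j) (S.e j)) p + hamVF (S.rem j) p := by
  rw [show S.limHam = fun p => ham w (S.c j) (S.e j) p + S.rem j p from funext (S.limHam_eq j)]
  exact hamVF_add ((contDiff_ham w _ (S.stageMap j)).differentiable (by simp) p)
    ((S.contDiff_rem j).differentiable (by simp) p)

lemma norm_hamVF_sub_le (j : ℕ) (p : Ph 3) :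
    ‖hamVF (ham w (S.c j) (S.e j)) p - hamVF S.limHam p‖ ≤ ‖hamCLM 3‖ * (2 * S.ε j) := by
  rw [S.hamVF_limHam j, sub_add_cancel_left, norm_neg, hamVF_eq]
  refine (ContinuousLinearMap.le_opNorm _ _).trans ?_
  gcongr
  rw [← norm_iteratedFDeriv_one]
  exact S.norm_iteratedFDeriv_rem_le j (by simp) p

end Scheme
end Scheme

section Limit

lemma hamVF_sum_actJ (w : Fin 3 → ℝ) (q : Ph 3) :
    hamVF (fun p => ∑ j, w j * actJ j p) q = (fun j => w j * q.2 j, fun j => -(w j * q.1 j)) := by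
  have hd : Differentiable ℝ fun r : Fin 3 → ℝ => ∑ j, w j * r j := by fun_prop
  have hf : ∀ r, freq (fun r : Fin 3 → ℝ => ∑ j, w j * r j) r = w := fun r => by
    let l : (Fin 3 → ℝ) →L[ℝ] ℝ := ∑ j, w j • ContinuousLinearMap.proj j
    have hl : (fun r : Fin 3 → ℝ => ∑ j, w j * r j) = l := by ext r; simp [l]
    rw [hl]
    ext j
    simp [freq, l, Pi.single_apply]
  have := hamVF_comp_act hd q
  rwa [hf] at this

lemma exists_lipschitz_hamVF_sum_actJ (w : Fin 3 → ℝ) :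
    ∃ K, LipschitzWith K (hamVF fun p => ∑ j, w j * actJ j p) := by
  let A : Ph 3 →ₗ[ℝ] Ph 3 :=
    { toFun := fun q => (fun j => w j * q.2 j, fun j => -(w j * q.1 j))
      map_add' := fun p q => by ext j <;> simp <;> ring
      map_smul' := fun c q => by ext j <;> simp <;> ring }
  rw [show hamVF (fun p => ∑ j, w j * actJ j p) = LinearMap.toContinuousLinearMap A from
    funext fun q => hamVF_sum_actJ w q]
  exact ⟨_, ContinuousLinearMap.lipschitz _⟩

lemma lipschitzWith_hamVF {H : Ph 3 → ℝ} (hH : ContDiff ℝ ∞ H) {C : NNReal}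
    (h : ∀ p, ‖iteratedFDeriv ℝ 2 H p‖ ≤ C) : LipschitzWith (‖hamCLM 3‖₊ * C) (hamVF H) := by
  rw [show hamVF H = hamCLM 3 ∘ fderiv ℝ H from funext (hamVF_eq H)]
  refine (hamCLM 3).lipschitz.comp (lipschitzWith_of_nnnorm_fderiv_le (𝕜 := ℝ)
    ((hH.fderiv_right (m := ∞) (by simp)).differentiable (by simp)) fun p => ?_)
  have := h p
  rwa [← norm_iteratedFDeriv_fderiv, norm_iteratedFDeriv_one] at this

namespace Scheme
variable {w : Fin 3 → ℝ} {L : ℝ} {ν : ℕ → ℤ} {Q : ℕ → Set (Ph 3)} (S : Scheme w L ν Q)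

lemma ham_zero (p : Ph 3) : ham w (S.c 0) (S.e 0) p = ∑ j, w j * actJ j p := by
  rw [S.c_zero, S.e_zero]
  simp [ham, intHam, act]

lemma isEllipticNF_limHam : IsEllipticNF w S.limHam := by
  intro k hk
  rw [show (fun p => S.limHam p - ∑ j, w j * actJ j p) = S.rem 0 from
    funext fun p => by rw [limHam, S.ham_zero, add_sub_cancel_left]]
  exact S.iteratedFDeriv_rem_zero 0 hk

lemma lipschitzWith_hamVF_limHam {K : NNReal}
    (hK : LipschitzWith K (hamVF fun p => ∑ j, w j * actJ j p)) :
    LipschitzWith (K + ‖hamCLM 3‖₊ * 2) (hamVF S.limHam) := by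
  rw [show hamVF S.limHam = fun p => hamVF (fun p => ∑ j, w j * actJ j p) p + hamVF (S.rem 0) p from
    funext fun p => by rw [S.hamVF_limHam 0, funext S.ham_zero]]
  refine hK.add (lipschitzWith_hamVF (S.contDiff_rem 0) fun p => ?_)
  simpa [S.ε_zero] using S.norm_iteratedFDeriv_rem_le 0 le_rfl p

lemma tendsto_ε : Tendsto S.ε atTop (𝓝 0) := by
  refine squeeze_zero (fun j => (S.ε_pos j).le) (le_geometric S.ε_half) ?_
  simpa using (tendsto_pow_atTop_nhds_zero_of_lt_one (r := (1 / 2 : ℝ)) (by norm_num)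
    (by norm_num)).const_mul (S.ε 0)

variable {K : NNReal} {Φ : ℝ → Ph 3 → Ph 3}

lemma dist_flow_curve_le (hK1 : 1 ≤ K) (hK : LipschitzWith K (hamVF S.limHam))
    (hΦ : IsGlobalFlow S.limHam Φ) (j : ℕ) (p : Ph 3) (t : ℝ) :
    dist (Φ t p) (curve w (S.c j) (S.e j) p t) ≤
      ‖hamCLM 3‖ * (2 * S.ε j) * Real.exp (K * |t|) := by
  obtain ⟨h0, -, hd⟩ := hΦ
  have hc := hasDerivAt_curve w (S.c j) (S.stageMap j) p
  rcases le_total 0 t with ht | ht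
  · rw [abs_of_nonneg ht]
    exact dist_integralCurve_le hK1 hK (S.norm_hamVF_sub_le j) (f := fun t => Φ t p) (hd p) hc
      (by simp [h0]) ht
  · rw [abs_of_nonpos ht]
    have := dist_integralCurve_le (v := fun z => -hamVF S.limHam z)
      (u := fun z => -hamVF (ham w (S.c j) (S.e j)) z) hK1 hK.neg
      (ε := ‖hamCLM 3‖ * (2 * S.ε j)) (fun z => ?_) (f := fun t => Φ (-t) p)
      (g := fun t => curve w (S.c j) (S.e j) p (-t)) (fun t => ?_) (fun t => ?_)
      (by simp [h0]) (neg_nonneg.2 ht)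
    · simpa using this
    · rw [neg_sub_neg, norm_sub_rev]; exact S.norm_hamVF_sub_le j z
    · simpa [Function.comp_def] using (hd p (-t)).scomp t (hasDerivAt_neg t)
    · simpa [Function.comp_def] using (hc (-t)).scomp t (hasDerivAt_neg t)

lemma act_flow (hK1 : 1 ≤ K) (hK : LipschitzWith K (hamVF S.limHam))
    (hΦ : IsGlobalFlow S.limHam Φ) {p : Ph 3} (hp : act p ∉ actReg) (t : ℝ) :
    act (Φ t p) = act p := by
  have h1 : Tendsto (fun j => curve w (S.c j) (S.e j) p t) atTop (𝓝 (Φ t p)) := by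
    rw [tendsto_iff_dist_tendsto_zero]
    refine squeeze_zero (fun _ => dist_nonneg)
      (fun j => (dist_comm _ _).trans_le (S.dist_flow_curve_le hK1 hK hΦ j p t)) ?_
    simpa using ((S.tendsto_ε.const_mul 2).const_mul ‖hamCLM 3‖).mul_const (Real.exp (K * |t|))
  refine tendsto_nhds_unique ((continuous_act.tendsto _).comp h1) ?_
  refine tendsto_const_nhds.congr fun j => ?_
  exact (act_curve w (S.c j) (S.stageMap j) hp t).symm

lemma dist_flow_curve_succ_le (hK1 : 1 ≤ K) (hKL : K ≤ L)
    (hK : LipschitzWith K (hamVF S.limHam))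
    (hΦ : IsGlobalFlow S.limHam Φ) (j : ℕ) (p : Ph 3) {t : ℝ} (ht : t ∈ Icc 0 (S.T j)) :
    dist (Φ t p) (curve w (S.c (j + 1)) (S.e (j + 1)) p t) ≤ 2 * ‖hamCLM 3‖ / (j + 1) := by
  refine (S.dist_flow_curve_le hK1 hK hΦ (j + 1) p t).trans ?_
  rw [abs_of_nonneg ht.1]
  have h1 : Real.exp (K * t) ≤ Real.exp (L * S.T j) := by
    exact Real.exp_le_exp.2 ((mul_le_mul_of_nonneg_right hKL ht.1).trans
      (mul_le_mul_of_nonneg_left ht.2 (K.coe_nonneg.trans hKL)))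
  have h2 := S.ε_pos (j + 1)
  calc ‖hamCLM 3‖ * (2 * S.ε (j + 1)) * Real.exp (K * t)
      ≤ ‖hamCLM 3‖ * (2 * S.ε (j + 1)) * Real.exp (L * S.T j) := by gcongr
    _ = 2 * ‖hamCLM 3‖ * (S.ε (j + 1) * Real.exp (L * S.T j)) := by ring
    _ ≤ 2 * ‖hamCLM 3‖ * (1 / (j + 1)) := by gcongr; exact S.ε_le j
    _ = _ := by ring

end Scheme

/-- The union of the coordinate subspaces and the walls `r₃ = 2 ^ m`. -/
def singSet : Set (Ph 3) := {q | act q ∉ actReg}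

/-- The points of norm at most `j` at distance at least `1 / (j + 1)` from the singular set. -/
def core (j : ℕ) : Set (Ph 3) := closedBall 0 j ∩ {z | 1 / (j + 1 : ℝ) ≤ infDist z singSet}

lemma isCompact_core (j : ℕ) : IsCompact (core j) :=
  (isCompact_closedBall _ _).inter_right (isClosed_le continuous_const (continuous_infDist_pt _))

lemma act_mem_of_mem_core {j : ℕ} {z : Ph 3} (hz : z ∈ core j) : act z ∈ actReg := by
  by_contra hc
  have h1 : infDist z singSet = 0 := infDist_zero_of_mem (s := singSet) hc
  have h2 : 1 / (j + 1 : ℝ) ≤ infDist z singSet := hz.2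
  have h3 : 0 < 1 / (j + 1 : ℝ) := by positivity
  linarith

/-- An orbit shadowed by points escaping from the sets `core j` is unbounded or accumulates on the
singular set. -/
lemma exists_times {f : ℝ → Ph 3} {C : ℝ} (hf : ∀ N : ℕ, ∃ j ≥ N, ∃ t, ∃ z ∉ core j,
    dist (f t) z ≤ C / (j + 1)) : ∃ t : ℕ → ℝ, Tendsto (fun j => ‖f (t j)‖) atTop atTop ∨
      Tendsto (fun j => infDist (f (t j)) singSet) atTop (𝓝 0) := by
  by_cases hb : ∃ R, ∀ t, ‖f t‖ ≤ R
  · obtain ⟨R, hR⟩ := hb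
    obtain ⟨M, hM⟩ := exists_nat_ge (R + |C|)
    choose j hj t z hz hd using fun N : ℕ => hf (N + M)
    refine ⟨t, Or.inr ?_⟩
    have hC : ∀ N, C / (j N + 1) ≤ |C| / (N + 1) := fun N => by
      have : (N : ℝ) ≤ j N := by exact_mod_cast (by have := hj N; lia : N ≤ j N)
      gcongr
      exact le_abs_self C
    refine squeeze_zero (fun _ => infDist_nonneg)
      (g := fun N : ℕ => (1 + |C|) * (1 / ((N : ℝ) + 1)))
      (fun N => ?_) (by simpa using tendsto_one_div_add_atTop_nhds_zero_nat.const_mul (1 + |C|))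
    have h1 : ‖z N‖ ≤ j N := by
      have h3 : ‖z N‖ ≤ ‖f (t N)‖ + dist (f (t N)) (z N) := by
        rw [dist_eq_norm]
        linarith [norm_sub_norm_le (z N) (f (t N)), norm_sub_rev (z N) (f (t N))]
      have h4 : (M : ℝ) ≤ j N := by exact_mod_cast (by have := hj N; lia : M ≤ j N)
      have h5 : |C| / (N + 1 : ℝ) ≤ |C| :=
        div_le_self (abs_nonneg C) (by linarith [N.cast_nonneg (α := ℝ)])
      linarith [hR (t N), hd N, hC N]
    have h2 : infDist (z N) singSet < 1 / (j N + 1 : ℝ) := by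
      by_contra! hc
      exact hz N ⟨mem_closedBall_zero_iff.2 h1, hc⟩
    have h3 : 1 / (j N + 1 : ℝ) ≤ 1 / (N + 1) := by
      have : (N : ℝ) ≤ j N := by exact_mod_cast (by have := hj N; lia : N ≤ j N)
      gcongr
    calc infDist (f (t N)) singSet ≤ infDist (z N) singSet + dist (f (t N)) (z N) :=
          infDist_le_infDist_add_dist
      _ ≤ 1 / (N + 1) + |C| / (N + 1) := by linarith [hd N, hC N]
      _ = _ := by ring
  · push Not at hb
    choose t ht using fun N : ℕ => hb N
    exact ⟨t, Or.inl (tendsto_atTop_mono (fun N => (ht N).le) tendsto_natCast_atTop_atTop)⟩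

end Limit

lemma singSet_eq : singSet = {q : Ph 3 | ∃ i, actJ i q = 0} ∪
    {q : Ph 3 | ∃ n : ℤ, actJ 2 q = (2 : ℝ) ^ n} := by
  ext q
  have h : ∀ i, 0 < act q i ↔ ¬actJ i q = 0 := fun i =>
    (act_nonneg q i).lt_iff_ne.trans ne_comm
  change ¬((∀ i, 0 < act q i) ∧ ∀ m : ℤ, actJ 2 q ≠ 2 ^ m) ↔
    (∃ i, actJ i q = 0) ∨ ∃ n : ℤ, actJ 2 q = 2 ^ n
  simp only [h]
  rw [not_and_or]
  push Not
  rfl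

lemma tendsto_two_zpow_atTop : Tendsto (fun n : ℤ => (2 : ℝ) ^ n) atTop atTop :=
  tendsto_atTop_atTop_of_monotone (zpow_right_strictMono₀ one_lt_two).monotone fun b =>
    let ⟨n, hn⟩ := pow_unbounded_of_one_lt b (one_lt_two (α := ℝ))
    ⟨n, by simpa using hn.le⟩

theorem statement3 (ω₀ : Fin 3 → ℝ) :
    ∃ H : Ph 3 → ℝ, ContDiff ℝ (⊤ : ℕ∞) H ∧ IsEllipticNF ω₀ H ∧
      ∃ Φ : ℝ → Ph 3 → Ph 3, IsGlobalFlow H Φ ∧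
      ∃ a : ℤ → ℝ, (∀ n, 0 < a n) ∧
        Tendsto a atBot (𝓝 0) ∧ Tendsto a atTop atTop ∧
        (∀ n : ℤ, ∀ t : ℝ, ∀ p : Ph 3, actJ 2 p = a n →
          actJ 2 (Φ t p) = a n ∧ ∀ j : Fin 3, actJ j (Φ t p) = actJ j p) ∧
        (∀ i : Fin 3, ∀ t : ℝ, ∀ p : Ph 3, actJ i p = 0 →
          actJ i (Φ t p) = 0 ∧ ∀ j : Fin 3, actJ j (Φ t p) = actJ j p) ∧
        (∀ p : Ph 3, (∀ i, actJ i p ≠ 0) → (∀ n : ℤ, actJ 2 p ≠ a n) →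
          ∃ t : ℕ → ℝ,
            Tendsto (fun j => ‖Φ (t j) p‖) atTop atTop ∨
            Tendsto (fun j => infDist (Φ (t j) p)
              ({q : Ph 3 | ∃ i, actJ i q = 0} ∪ {q : Ph 3 | ∃ n : ℤ, actJ 2 q = a n}))
              atTop (𝓝 0)) := by
  obtain ⟨K₀, hK₀⟩ := exists_lipschitz_hamVF_sum_actJ ω₀
  set K : NNReal := max 1 (K₀ + ‖hamCLM 3‖₊ * 2)
  obtain ⟨ν, hν⟩ := exists_itinerary
  obtain ⟨S⟩ := nonempty_scheme ω₀ K ν isCompact_core fun j z => act_mem_of_mem_core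
  have hK1 : 1 ≤ K := le_max_left _ _
  have hK : LipschitzWith K (hamVF S.limHam) :=
    (S.lipschitzWith_hamVF_limHam hK₀).weaken (le_max_right _ _)
  obtain ⟨Φ, hΦ⟩ := exists_global_flow ((contDiff_hamVF S.contDiff_limHam).of_le (by simp)) hK
  have hinv : ∀ p ∈ singSet, ∀ t j, actJ j (Φ t p) = actJ j p := fun p hp t j =>
    congrFun (S.act_flow hK1 hK hΦ hp t) j
  rw [singSet_eq] at hinv
  refine ⟨S.limHam, S.contDiff_limHam, S.isEllipticNF_limHam, Φ, hΦ, fun n => 2 ^ n,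
    fun n => by positivity, ?_, tendsto_two_zpow_atTop,
    fun n t p hp => ?_, fun i t p hp => ?_, fun p hp hp' => ?_⟩
  · have h : Tendsto (fun n : ℤ => ((2 : ℝ) ^ (-n))⁻¹) atBot (𝓝 0) :=
      (tendsto_two_zpow_atTop.comp tendsto_neg_atBot_atTop).inv_tendsto_atTop
    simpa using h
  · have := hinv p (Or.inr ⟨n, hp⟩) t
    exact ⟨(this 2).trans hp, this⟩
  · have := hinv p (Or.inl ⟨i, hp⟩) t
    exact ⟨(this i).trans hp, this⟩
  · have hreg : act p ∈ actReg := ⟨fun i => (act_nonneg p i).lt_of_ne' (hp i), hp'⟩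
    rw [← singSet_eq]
    refine exists_times (f := fun t => Φ t p) (C := 2 * ‖hamCLM 3‖) fun N => ?_
    obtain ⟨j, hj, t, ht, hz⟩ := S.exists_exit hν hreg N
    exact ⟨j, hj, t, _, hz, S.dist_flow_curve_succ_le hK1 le_rfl hK hΦ j p ht⟩
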